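/- arXiv:1202.6310 — 4 statements merged into one kernel-verified Lean document; each statement's English description precedes it below -/
import Mathlib

section
/- Every Eberlein–Grothendieck pseudocompact scattered space is σ-discrete. -/
open Set Topology Ordinal Cardinal

noncomputable section
universe u

/-- A topological space is *scattered* if every nonempty subset has a point isolated
in the subspace topology, i.e. there is an open set meeting the subset in exactly
that point. -/
def IsScattered (X : Type*) [TopologicalSpace X] : Prop :=
  ∀ S : Set X, S.Nonempty → ∃ x ∈ S, ∃ U : Set X, IsOpen U ∧ U ∩ S = {x}

/-- A space is *meta-Lindelöf* if every open cover has a point-countable open refinement. -/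
def IsMetaLindelof (X : Type*) [TopologicalSpace X] : Prop :=
  ∀ 𝒰 : Set (Set X), (∀ U ∈ 𝒰, IsOpen U) → ⋃₀ 𝒰 = Set.univ →
    ∃ 𝒱 : Set (Set X), (∀ V ∈ 𝒱, IsOpen V) ∧ ⋃₀ 𝒱 = Set.univ ∧
      (∀ V ∈ 𝒱, ∃ U ∈ 𝒰, V ⊆ U) ∧ ∀ x : X, {V ∈ 𝒱 | x ∈ V}.Countable

/-- A space is *hereditarily meta-Lindelöf* if every subspace is meta-Lindelöf. -/
def HereditarilyMetaLindelof (X : Type*) [TopologicalSpace X] : Prop :=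
  ∀ S : Set X, IsMetaLindelof S

/-- A space is *σ-discrete* if it is a countable union of subspaces, each of which is
discrete in its subspace topology. -/
def IsSigmaDiscrete (X : Type*) [TopologicalSpace X] : Prop :=
  ∃ D : ℕ → Set X, (⋃ n, D n) = Set.univ ∧ ∀ n, DiscreteTopology (D n)

/-- The Cantor–Bendixson derivatives `cbDeriv X α = X^(α)`: for each `β < α` we intersect
the set of non-isolated points of `X^(β)`.  This agrees with the usual transfinite
iteration: `X^(0) = X`, `X^(α+1)` is the set of non-isolated points of `X^(α)`, and at
limit ordinals one takes intersections. -/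
def cbDeriv (X : Type*) [TopologicalSpace X] (o : Ordinal) : Set X :=
  ⋂ p : {b : Ordinal // b < o},
    (cbDeriv X p.1 ∩ {x | x ∈ closure (cbDeriv X p.1 \ {x})})
termination_by o
decreasing_by exact p.2

/-- The Cantor–Bendixson height of a space: the least ordinal `α` with `X^(α) = ∅`. -/
def cbHeight (X : Type*) [TopologicalSpace X] : Ordinal :=
  sInf {o : Ordinal | cbDeriv X o = ∅}

/-- A space `X` is *Eberlein–Grothendieck* if it embeds into `C_p(K)`, the space of
continuous real-valued functions on a compact Hausdorff space `K` with the topology of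
pointwise convergence (the subspace topology from the product topology on `K → ℝ`). -/
def EberleinGrothendieck (X : Type u) [TopologicalSpace X] : Prop :=
  ∃ (K : Type u) (_ : TopologicalSpace K), CompactSpace K ∧ T2Space K ∧
    ∃ f : X → {g : K → ℝ // Continuous g}, IsEmbedding f

/-- The weight of a topological space: the least cardinality of a base for the topology. -/
def tweight (X : Type u) [TopologicalSpace X] : Cardinal.{u} :=
  sInf {c : Cardinal.{u} | ∃ B : Set (Set X), TopologicalSpace.IsTopologicalBasis B ∧ #B = c}

/-- A space is *locally countable* if every point has a countable open neighborhood. -/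
def LocallyCountable (X : Type*) [TopologicalSpace X] : Prop :=
  ∀ x : X, ∃ U : Set X, IsOpen U ∧ x ∈ U ∧ U.Countable

/-- A Tychonoff space is *pseudocompact* if every continuous real-valued function on it
is bounded. -/
def Pseudocompact (X : Type*) [TopologicalSpace X] : Prop :=
  ∀ f : X → ℝ, Continuous f → ∃ M : ℝ, ∀ x : X, |f x| ≤ M

/-- A subset `s` of a space is *covered by countably many discrete sets*; discreteness of a set is
spelled out as in the definition of scattered spaces. -/
def SigmaDiscreteOn {X : Type*} [TopologicalSpace X] (s : Set X) : Prop :=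
  ∃ D : ℕ → Set X, s ⊆ ⋃ n, D n ∧ ∀ n, ∀ x ∈ D n, ∃ U, IsOpen U ∧ U ∩ D n = {x}

namespace SigmaDiscreteOn

variable {X : Type*} [TopologicalSpace X]

theorem mono {s t : Set X} (h : SigmaDiscreteOn t) (hst : s ⊆ t) : SigmaDiscreteOn s := by
  obtain ⟨D, h1, h2⟩ := h
  exact ⟨D, hst.trans h1, h2⟩

theorem iUnion_nat {s : ℕ → Set X} (h : ∀ n, SigmaDiscreteOn (s n)) :
    SigmaDiscreteOn (⋃ n, s n) := by
  choose D h1 h2 using h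
  refine ⟨fun n => D n.unpair.1 n.unpair.2, ?_, fun n => h2 _ _⟩
  refine iUnion_subset fun n x hx => ?_
  obtain ⟨m, hm⟩ := mem_iUnion.1 (h1 n hx)
  exact mem_iUnion.2 ⟨Nat.pair n m, by simpa using hm⟩

theorem iUnion {ι : Type*} [Countable ι] {s : ι → Set X} (h : ∀ i, SigmaDiscreteOn (s i)) :
    SigmaDiscreteOn (⋃ i, s i) := by
  rcases isEmpty_or_nonempty ι with hι | hι
  · exact ⟨fun _ => ∅, by simp, by simp⟩
  · obtain ⟨f, hf⟩ := exists_surjective_nat ι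
    rw [← hf.iUnion_comp]
    exact iUnion_nat fun n => h _

theorem singleton (x : X) : SigmaDiscreteOn ({x} : Set X) :=
  ⟨fun _ => {x}, by simp, fun _ y hy => ⟨univ, isOpen_univ, by simpa using hy.symm⟩⟩

theorem union {s t : Set X} (hs : SigmaDiscreteOn s) (ht : SigmaDiscreteOn t) :
    SigmaDiscreteOn (s ∪ t) := by
  rw [union_eq_iUnion]
  exact iUnion (by rintro (_ | _) <;> assumption)

/-- A compact set which is locally covered by countably many discrete sets is so covered. -/
theorem of_isCompact {s : Set X} (hs : IsCompact s)
    (h : ∀ x ∈ s, ∃ U, IsOpen U ∧ x ∈ U ∧ SigmaDiscreteOn U) : SigmaDiscreteOn s := by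
  refine hs.induction_on (p := SigmaDiscreteOn) ⟨fun _ => ∅, by simp, by simp⟩
    (fun _ _ hst ht => ht.mono hst) (fun _ _ => union) fun x hx => ?_
  obtain ⟨U, hU, hxU, hD⟩ := h x hx
  exact ⟨U, mem_nhdsWithin_of_mem_nhds (hU.mem_nhds hxU), hD⟩

theorem iUnion_of_pointFinite {ι : Type*} {V : ι → Set X} (hV : ∀ i, IsOpen (V i))
    (hfin : ∀ x, {i | x ∈ V i}.Finite) (h : ∀ i, SigmaDiscreteOn (V i)) :
    SigmaDiscreteOn (⋃ i, V i) := by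
  classical
  choose D hcov hD using h
  rcases isEmpty_or_nonempty ι with hι | hι
  · exact ⟨fun _ => ∅, by simp, by simp⟩
  let g : Set ι → ι := fun T => if hT : T.Nonempty then hT.some else Classical.arbitrary ι
  have hg : ∀ T : Set ι, T.Nonempty → g T ∈ T := fun T hT => by
    simp only [g, dif_pos hT]; exact hT.some_mem
  let E : ℕ → Set X := fun n =>
    {x | {i | x ∈ V i}.ncard = n.unpair.1 ∧ x ∈ D (g {i | x ∈ V i}) n.unpair.2}
  refine ⟨E, fun x hx => ?_, fun n x hx => ?_⟩
  · obtain ⟨i, hi⟩ := mem_iUnion.1 hx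
    obtain ⟨m, hm⟩ := mem_iUnion.1 (hcov _ (hg {i | x ∈ V i} ⟨i, hi⟩))
    exact mem_iUnion.2 ⟨Nat.pair ({i | x ∈ V i}.ncard) m, by simpa [E] using hm⟩
  · obtain ⟨U, hU, hUx⟩ := hD _ _ x hx.2
    refine ⟨U ∩ ⋂ i ∈ {i | x ∈ V i}, V i,
      hU.inter ((hfin x).isOpen_biInter fun i _ => hV i), Subset.antisymm ?_ ?_⟩
    · rintro z ⟨⟨hzU, hzV⟩, hz⟩
      have hsub : {i | x ∈ V i} ⊆ {i | z ∈ V i} := fun i hi => mem_iInter₂.1 hzV i hi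
      have heq : {i | x ∈ V i} = {i | z ∈ V i} :=
        eq_of_subset_of_ncard_le hsub (by rw [hz.1, hx.1]) (hfin z)
      rw [← hUx]
      exact ⟨hzU, by rw [heq]; exact hz.2⟩
    · rintro _ rfl
      exact ⟨⟨(hUx.ge rfl).1, by simp⟩, hx⟩

theorem isSigmaDiscrete (h : SigmaDiscreteOn (univ : Set X)) : IsSigmaDiscrete X := by
  obtain ⟨D, hcov, hD⟩ := h
  refine ⟨D, univ_subset_iff.1 hcov, fun n => ?_⟩
  refine discreteTopology_iff_isOpen_singleton.2 fun x => ?_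
  obtain ⟨U, hU, hUx⟩ := hD n x x.2
  refine ⟨U, hU, ?_⟩
  ext y
  have : (y : X) ∈ U ∩ D n ↔ (y : X) = x := by rw [hUx]; rfl
  simpa [Subtype.ext_iff] using this

end SigmaDiscreteOn

/-- A family of functions `φ γ` on `X` is a *continuous injection into `c₀`*. -/
structure IsC0Injection {X Γ : Type*} [TopologicalSpace X] (φ : Γ → X → ℝ) : Prop where
  continuous : ∀ γ, Continuous (φ γ)
  finite : ∀ x, ∀ ε > 0, {γ | ε < |φ γ x|}.Finite
  separates : ∀ x y, (∀ γ, φ γ x = φ γ y) → x = y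

namespace IsC0Injection

variable {X Γ : Type*} [TopologicalSpace X] {φ : Γ → X → ℝ}

theorem finite_sub (h : IsC0Injection φ) (x y : X) {ε : ℝ} (hε : 0 < ε) :
    {γ | ε < |φ γ x - φ γ y|}.Finite := by
  refine ((h.finite x (ε / 2) (by linarith)).union (h.finite y (ε / 2) (by linarith))).subset ?_
  intro γ hγ
  by_contra hcon
  simp only [mem_union, mem_ofPred_eq, not_or, not_lt] at hcon hγ
  linarith [abs_sub (φ γ x) (φ γ y)]

theorem exists_lt_abs_sub (h : IsC0Injection φ) {x y : X} (hxy : x ≠ y) :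
    ∃ γ, ∃ n : ℕ, 1 / ((n : ℝ) + 1) < |φ γ x - φ γ y| := by
  by_contra! hcon
  refine hxy (h.separates x y fun γ => ?_)
  by_contra hne
  obtain ⟨n, hn⟩ := exists_nat_one_div_lt (abs_pos.2 (sub_ne_zero.2 hne))
  exact absurd (hcon γ n) (not_le.2 hn)

/-- A scattered compact space that injects continuously into `c₀` is covered by countably many
discrete sets. -/
theorem sigmaDiscreteOn_univ [CompactSpace X] [T2Space X] (h : IsC0Injection φ)
    (hsc : IsScattered X) : SigmaDiscreteOn (univ : Set X) := by
  by_contra hcon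
  let S : Set X := {x | ∀ U, IsOpen U → x ∈ U → ¬ SigmaDiscreteOn U}
  have hS : S.Nonempty := by
    by_contra hemp
    refine hcon (SigmaDiscreteOn.of_isCompact isCompact_univ fun x _ => ?_)
    by_contra! hx
    exact hemp ⟨x, hx⟩
  obtain ⟨p, hpS, U, hU, hUp⟩ := hsc S hS
  have hpU : p ∈ U := (hUp.ge rfl).1
  obtain ⟨N, hN, hNc, hNU⟩ := exists_mem_nhds_isClosed_subset (hU.mem_nhds hpU)
  refine hpS (interior N) isOpen_interior (mem_interior_iff_mem_nhds.2 hN) ?_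
  let V : ℕ → Γ → Set X := fun n γ => interior N ∩ {x | 1 / ((n : ℝ) + 1) < |φ γ x - φ γ p|}
  have hcont : ∀ γ, Continuous fun x => |φ γ x - φ γ p| := fun γ =>
    ((h.continuous γ).sub continuous_const).abs
  have hVσ : ∀ n γ, SigmaDiscreteOn (V n γ) := fun n γ => by
    have hC : IsClosed (N ∩ {x | 1 / ((n : ℝ) + 1) ≤ |φ γ x - φ γ p|}) :=
      hNc.inter (isClosed_le continuous_const (hcont γ))
    refine (SigmaDiscreteOn.of_isCompact hC.isCompact fun x hx => ?_).mono
      (inter_subset_inter interior_subset fun x hx => (mem_ofPred.1 hx).le)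
    by_contra! hx'
    have hxp : x = p := by
      have : x ∈ U ∩ S := ⟨hNU hx.1, hx'⟩
      rwa [hUp] at this
    have h2 : 1 / ((n : ℝ) + 1) ≤ |φ γ x - φ γ p| := hx.2
    rw [hxp, _root_.sub_self, abs_zero] at h2
    exact absurd h2 (not_le.2 Nat.one_div_pos_of_nat)
  have hall : SigmaDiscreteOn (⋃ n, ⋃ γ, V n γ) :=
    SigmaDiscreteOn.iUnion fun n => SigmaDiscreteOn.iUnion_of_pointFinite
      (fun γ => isOpen_interior.inter (isOpen_lt continuous_const (hcont γ)))
      (fun x => (h.finite_sub x p Nat.one_div_pos_of_nat).subset fun γ hγ => hγ.2) (hVσ n)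
  refine ((SigmaDiscreteOn.singleton p).union hall).mono fun x hx => ?_
  by_cases hxp : x = p
  · exact Or.inl hxp
  · obtain ⟨γ, n, hn⟩ := h.exists_lt_abs_sub hxp
    exact Or.inr (mem_iUnion₂.2 ⟨n, γ, hx, hn⟩)

end IsC0Injection

namespace Pseudocompact

/-- In a pseudocompact space, countably many continuous functions with approximate common zeros have
a common zero. -/
theorem exists_forall_eq_zero {X : Type*} [TopologicalSpace X] (hpc : Pseudocompact X)
    (g : ℕ → X → ℝ) (hg : ∀ i, Continuous (g i))
    (h : ∀ N : ℕ, ∀ ε > 0, ∃ x, ∀ i < N, |g i x| < ε) : ∃ x, ∀ i, g i x = 0 := by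
  let t : ℕ → X → ℝ := fun i x => (1 / 2 : ℝ) ^ i * min 1 |g i x|
  have ht0 : ∀ i x, 0 ≤ t i x := fun i x => by positivity
  have ht1 : ∀ i x, t i x ≤ (1 / 2 : ℝ) ^ i := fun i x =>
    mul_le_of_le_one_right (by positivity) (min_le_left _ _)
  have hsum : ∀ x, Summable fun i => t i x := fun x =>
    Summable.of_nonneg_of_le (fun i => ht0 i x) (fun i => ht1 i x) summable_geometric_two
  let F : X → ℝ := fun x => ∑' i, t i x
  have hF : Continuous F := by
    refine continuous_tsum (fun i => ?_) summable_geometric_two fun i x => ?_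
    · exact continuous_const.mul (continuous_const.min (hg i).abs)
    · rw [Real.norm_of_nonneg (ht0 i x)]; exact ht1 i x
  by_contra! hcon
  have hpos : ∀ x, 0 < F x := fun x => by
    obtain ⟨i, hi⟩ := hcon x
    have : 0 < t i x := by
      have := abs_pos.2 hi
      positivity
    exact (hsum x).tsum_pos (fun i => ht0 i x) i this
  obtain ⟨M, hM⟩ := hpc (fun x => (F x)⁻¹) (hF.inv₀ fun x => (hpos x).ne')
  have hM' : ∀ x, 1 ≤ M * F x := fun x => by
    have h1 := (le_abs_self _).trans (hM x)
    have h2 := mul_le_mul_of_nonneg_right h1 (hpos x).le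
    rwa [inv_mul_cancel₀ (hpos x).ne'] at h2
  have hMpos : 0 < M := by
    obtain ⟨x, -⟩ := h 0 1 one_pos
    by_contra! hM0
    have := mul_nonpos_of_nonpos_of_nonneg hM0 (hpos x).le
    linarith [hM' x]
  obtain ⟨N, hN⟩ := exists_pow_lt_of_lt_one (show 0 < 1 / (8 * M) by positivity)
    (show (1 / 2 : ℝ) < 1 by norm_num)
  obtain ⟨x, hx⟩ := h N (1 / (8 * M)) (by positivity)
  have hhead : ∑ i ∈ Finset.range N, t i x ≤ 2 * (1 / (8 * M)) := by
    calc ∑ i ∈ Finset.range N, t i x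
        ≤ ∑ i ∈ Finset.range N, (1 / 2 : ℝ) ^ i * (1 / (8 * M)) := by
          refine Finset.sum_le_sum fun i hi => ?_
          exact mul_le_mul_of_nonneg_left
            ((min_le_right _ _).trans (hx i (Finset.mem_range.1 hi)).le) (by positivity)
      _ = (∑ i ∈ Finset.range N, (1 / 2 : ℝ) ^ i) * (1 / (8 * M)) := by rw [Finset.sum_mul]
      _ ≤ 2 * (1 / (8 * M)) :=
          mul_le_mul_of_nonneg_right (sum_geometric_two_le N) (by positivity)
  have htail : ∑' i, t (i + N) x ≤ 2 * (1 / 2 : ℝ) ^ N := by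
    calc ∑' i, t (i + N) x ≤ ∑' i : ℕ, (1 / 2 : ℝ) ^ i * (1 / 2 : ℝ) ^ N := by
          refine Summable.tsum_le_tsum (fun i => ?_) ((summable_nat_add_iff N).2 (hsum x))
            (summable_geometric_two.mul_right _)
          rw [← pow_add]; exact ht1 _ _
      _ = 2 * (1 / 2 : ℝ) ^ N := by rw [tsum_mul_right, tsum_geometric_two]
  have hsplit : ∑ i ∈ Finset.range N, t i x + ∑' i, t (i + N) x = F x :=
    (hsum x).sum_add_tsum_nat_add N
  have hle : F x < 4 * (1 / (8 * M)) := by linarith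
  have h1 : M * F x < M * (4 * (1 / (8 * M))) := mul_lt_mul_of_pos_left hle hMpos
  have h2 : M * (4 * (1 / (8 * M))) = 1 / 2 := by field_simp; norm_num
  linarith [hM' x]

/-- The pointwise closure of a pseudocompact space of continuous functions on a compact space
consists of continuous functions. -/
theorem continuous_of_mem_closure {X K : Type*} [TopologicalSpace X] [TopologicalSpace K]
    [CompactSpace K] (hpc : Pseudocompact X) {e : X → K → ℝ} (he : Continuous e)
    (hcont : ∀ x, Continuous (e x)) {h : K → ℝ} (hh : h ∈ closure (range e)) :
    Continuous h := by
  classical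
  rw [continuous_iff_continuousAt]
  intro k₀
  by_contra hk₀
  obtain ⟨ε, hε, hbad⟩ : ∃ ε > 0, ∀ W ∈ 𝓝 k₀, ∃ k ∈ W, ε ≤ |h k - h k₀| := by
    by_contra! hcon
    refine hk₀ (Metric.tendsto_nhds.2 fun ε hε => ?_)
    obtain ⟨W, hW, hWε⟩ := hcon ε hε
    filter_upwards [hW] with k hk
    rw [Real.dist_eq]; exact hWε k hk
  have happ : ∀ (G : Finset K) (δ : ℝ), 0 < δ → ∃ x, ∀ k ∈ G, |e x k - h k| < δ := by
    intro G δ hδ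
    have hopen : IsOpen (⋂ k ∈ G, {u : K → ℝ | |u k - h k| < δ}) :=
      isOpen_biInter_finset fun k _ =>
        isOpen_lt ((continuous_apply k).sub continuous_const).abs continuous_const
    obtain ⟨_, hu, x, rfl⟩ := mem_closure_iff.1 hh _ hopen (by simp [hδ])
    exact ⟨x, by simpa using hu⟩
  have hpick : ∀ (F : Finset X) (δ : ℝ), 0 < δ →
      ∃ k, (∀ x ∈ F, |e x k - e x k₀| < δ) ∧ ε ≤ |h k - h k₀| := by
    intro F δ hδ
    have hW : ⋂ x ∈ F, {k | |e x k - e x k₀| < δ} ∈ 𝓝 k₀ := by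
      refine (isOpen_biInter_finset fun x _ => ?_).mem_nhds (by simp [hδ])
      exact isOpen_lt ((hcont x).sub continuous_const).abs continuous_const
    obtain ⟨k, hk, hk'⟩ := hbad _ hW
    exact ⟨k, by simpa using hk, hk'⟩
  obtain ⟨f, hfP, hfr⟩ := exists_seq_of_forall_finset_exists
    (fun a : K × X × ℕ => ε ≤ |h a.1 - h k₀| ∧ |e a.2.1 k₀ - h k₀| < 1 / ((a.2.2 : ℝ) + 1))
    (fun a b : K × X × ℕ => a.2.2 < b.2.2 ∧
      |e a.2.1 b.1 - e a.2.1 k₀| < 1 / ((b.2.2 : ℝ) + 1) ∧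
      |e b.2.1 a.1 - h a.1| < 1 / ((b.2.2 : ℝ) + 1)) (by
    intro s _
    let n := s.sup (fun a => a.2.2) + 1
    obtain ⟨k, hk, hk'⟩ := hpick (s.image fun a => a.2.1) (1 / ((n : ℝ) + 1))
      Nat.one_div_pos_of_nat
    obtain ⟨x, hx⟩ := happ (insert k₀ (s.image fun a => a.1)) (1 / ((n : ℝ) + 1))
      Nat.one_div_pos_of_nat
    refine ⟨(k, x, n), ⟨hk', hx k₀ (Finset.mem_insert_self _ _)⟩, fun a ha => ⟨?_, ?_, ?_⟩⟩
    · exact Nat.lt_succ_of_le (Finset.le_sup (f := fun a : K × X × ℕ => a.2.2) ha)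
    · exact hk _ (Finset.mem_image_of_mem _ ha)
    · exact hx _ (Finset.mem_insert_of_mem (Finset.mem_image_of_mem _ ha)))
  have hmono : StrictMono fun n => (f n).2.2 := fun m n hmn => (hfr m n hmn).1
  have hle : ∀ n, 1 / (((f n).2.2 : ℝ) + 1) ≤ 1 / ((n : ℝ) + 1) := fun n =>
    one_div_le_one_div_of_le (by positivity) (by
      have : (n : ℝ) ≤ (f n).2.2 := by exact_mod_cast hmono.id_le n
      linarith)
  have hlim : Filter.Tendsto (fun n : ℕ => 1 / ((n : ℝ) + 1)) Filter.atTop (𝓝 0) :=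
    tendsto_one_div_add_atTop_nhds_zero_nat
  let 𝓤 : Ultrafilter ℕ := Filter.hyperfilter ℕ
  have h𝓤 : (𝓤 : Filter ℕ) ≤ Filter.atTop := by
    rw [← Nat.cofinite_eq_atTop]; exact Filter.hyperfilter_le_cofinite
  obtain ⟨k₁, -, hk₁⟩ := isCompact_univ.ultrafilter_le_nhds (𝓤.map fun n => (f n).1) (by simp)
  have htend : Filter.Tendsto (fun n => (f n).1) 𝓤 (𝓝 k₁) := hk₁
  have hx₁ : ∀ n, e (f n).2.1 k₁ = e (f n).2.1 k₀ := fun n => by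
    have h1 : Filter.Tendsto (fun m => |e (f n).2.1 (f m).1 - e (f n).2.1 k₀|) 𝓤
        (𝓝 |e (f n).2.1 k₁ - e (f n).2.1 k₀|) :=
      ((((hcont _).tendsto k₁).comp htend).sub tendsto_const_nhds).abs
    have h2 : |e (f n).2.1 k₁ - e (f n).2.1 k₀| ≤ 0 := by
      refine le_of_tendsto_of_tendsto h1 (hlim.mono_left h𝓤) ?_
      filter_upwards [h𝓤 (Filter.eventually_gt_atTop n)] with m hm
      exact (hfr n m hm).2.1.le.trans (hle m)
    exact sub_eq_zero.1 (abs_nonpos_iff.1 h2)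
  let g : ℕ → X → ℝ := fun i x => match i with
    | 0 => e x k₀ - h k₀
    | 1 => e x k₁ - e x k₀
    | i + 2 => e x (f i).1 - h (f i).1
  have hev : ∀ k, Continuous fun x => e x k := fun k => (continuous_apply k).comp he
  obtain ⟨x, hx⟩ := hpc.exists_forall_eq_zero g (by
      rintro (_ | _ | i)
      · exact (hev _).sub continuous_const
      · exact (hev _).sub (hev _)
      · exact (hev _).sub continuous_const) (by
      intro N δ hδ
      obtain ⟨m, hm⟩ := exists_nat_one_div_lt hδ
      have hlt : 1 / (((f (m + N)).2.2 : ℝ) + 1) < δ := by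
        refine ((hle _).trans ?_).trans_lt hm
        exact one_div_le_one_div_of_le (by positivity) (by push_cast; linarith [N.cast_nonneg (α := ℝ)])
      refine ⟨(f (m + N)).2.1, ?_⟩
      rintro (_ | _ | i) hi
      · exact (hfP (m + N)).2.trans hlt
      · simpa [g, hx₁] using hδ
      · exact (hfr i (m + N) (by omega)).2.2.trans hlt)
  have h0 : e x k₀ = h k₀ := sub_eq_zero.1 (hx 0)
  have h1 : e x k₁ = e x k₀ := sub_eq_zero.1 (hx 1)
  have h2 : ∀ i, e x (f i).1 = h (f i).1 := fun i => sub_eq_zero.1 (hx (i + 2))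
  have h3 : ε ≤ |e x k₁ - e x k₀| := by
    refine ge_of_tendsto (((((hcont x).tendsto k₁).comp htend).sub tendsto_const_nhds).abs)
      (Filter.Eventually.of_forall fun n => ?_)
    simpa [h2, h0] using (hfP n).1
  rw [h1] at h3
  simp at h3
  linarith

end Pseudocompact

/-- A point-finite open family in a Baire space is finite on some nonempty open subset of any
given nonempty open set. -/
theorem exists_isOpen_subset_finite_inter {Z Γ : Type*} [TopologicalSpace Z] [BaireSpace Z]
    {V : Γ → Set Z} (hV : ∀ γ, IsOpen (V γ)) (hfin : ∀ z, {γ | z ∈ V γ}.Finite)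
    {O : Set Z} (hO : IsOpen O) (hne : O.Nonempty) :
    ∃ U ⊆ O, IsOpen U ∧ U.Nonempty ∧ {γ | (U ∩ V γ).Nonempty}.Finite := by
  let C : ℕ → Set Z := fun k => {z | {γ | z ∈ V γ}.ncard ≤ k}
  have hnhd : ∀ z, IsOpen (⋂ γ ∈ {γ | z ∈ V γ}, V γ) := fun z =>
    (hfin z).isOpen_biInter fun γ _ => hV γ
  have hsub : ∀ z y, y ∈ ⋂ γ ∈ {γ | z ∈ V γ}, V γ → {γ | z ∈ V γ} ⊆ {γ | y ∈ V γ} :=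
    fun z y hy γ hγ => mem_iInter₂.1 hy γ hγ
  have hC : ∀ k, IsClosed (C k) := fun k => by
    rw [← isOpen_compl_iff, isOpen_iff_mem_nhds]
    intro z hz
    filter_upwards [(hnhd z).mem_nhds (by simp)] with y hy
    simp only [C, mem_compl_iff, mem_ofPred_eq, not_le] at hz ⊢
    exact hz.trans_le (ncard_le_ncard (hsub z y hy) (hfin y))
  have hCu : ⋃ k, C k = Set.univ := eq_univ_of_forall fun z =>
    mem_iUnion.2 ⟨{γ | z ∈ V γ}.ncard, mem_ofPred.2 le_rfl⟩
  obtain ⟨w, hwO, hw⟩ := (dense_iUnion_interior_of_closed hC hCu).inter_open_nonempty O hO hne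
  obtain ⟨k, hk⟩ := mem_iUnion.1 hw
  let N : Set ℕ := (fun z => {γ | z ∈ V γ}.ncard) '' (O ∩ interior (C k))
  have hNb : BddAbove N := ⟨k, by
    rintro _ ⟨z, hz, rfl⟩
    exact mem_ofPred.1 (show z ∈ C k from interior_subset hz.2)⟩
  obtain ⟨z, hz, hzmax⟩ := Nat.sSup_mem (s := N) ⟨_, w, ⟨hwO, hk⟩, rfl⟩ hNb
  refine ⟨O ∩ interior (C k) ∩ ⋂ γ ∈ {γ | z ∈ V γ}, V γ, fun y hy => hy.1.1,
    (hO.inter isOpen_interior).inter (hnhd z), ⟨z, hz, by simp⟩, (hfin z).subset ?_⟩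
  rintro γ ⟨y, hy, hyγ⟩
  have heq : {γ | z ∈ V γ} = {γ | y ∈ V γ} := by
    refine eq_of_subset_of_ncard_le (hsub z y hy.2) ?_ (hfin y)
    exact (le_csSup hNb ⟨y, hy.1, rfl⟩).trans_eq hzmax.symm
  rw [heq]; exact hyγ

/-- A dense pseudocompact subspace of a compact space that injects continuously into `c₀` is the
whole space. -/
theorem IsC0Injection.surjective_of_denseRange {Z X Γ : Type*} [TopologicalSpace Z]
    [CompactSpace Z] [T2Space Z] [TopologicalSpace X] {φ : Γ → Z → ℝ} (h : IsC0Injection φ)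
    (hpc : Pseudocompact X) {e : X → Z} (he : Continuous e) (hd : DenseRange e) :
    Function.Surjective e := by
  classical
  intro p
  by_contra! hp
  let ψ : Γ → Z → ℝ := fun γ z => |φ γ z - φ γ p|
  have hψ : ∀ γ, Continuous (ψ γ) := fun γ => ((h.continuous γ).sub continuous_const).abs
  have hψp : ∀ γ, ψ γ p = 0 := fun γ => by simp [ψ]
  obtain ⟨f, hfP, hfr⟩ := exists_seq_of_forall_finset_exists
    (fun a : Set Z × Finset Γ × ℕ => IsOpen a.1 ∧ a.1.Nonempty ∧
      ∀ γ ∉ a.2.1, ∀ z ∈ a.1, ψ γ z ≤ 1 / ((a.2.2 : ℝ) + 1))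
    (fun a b : Set Z × Finset Γ × ℕ => a.2.2 < b.2.2 ∧
      ∀ γ ∈ a.2.1, ∀ z ∈ b.1, ψ γ z ≤ 1 / ((b.2.2 : ℝ) + 1)) (by
    intro s _
    let n := s.sup (fun a => a.2.2) + 1
    let F := s.biUnion fun a => a.2.1
    let O : Set Z := ⋂ γ ∈ F, {z | ψ γ z < 1 / ((n : ℝ) + 1)}
    have hO : IsOpen O := isOpen_biInter_finset fun γ _ => isOpen_lt (hψ γ) continuous_const
    have hpO : p ∈ O := by
      simp only [O, mem_iInter, mem_ofPred_eq, hψp]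
      exact fun _ _ => Nat.one_div_pos_of_nat
    obtain ⟨U, hUO, hU, hUne, hUfin⟩ := exists_isOpen_subset_finite_inter
      (V := fun γ => {z | 1 / ((n : ℝ) + 1) < ψ γ z})
      (fun γ => isOpen_lt continuous_const (hψ γ))
      (fun z => h.finite_sub z p Nat.one_div_pos_of_nat) hO ⟨p, hpO⟩
    refine ⟨(U, hUfin.toFinset, n), ⟨hU, hUne, fun γ hγ z hz => ?_⟩, fun a ha => ⟨?_, ?_⟩⟩
    · by_contra! hlt
      exact hγ (hUfin.mem_toFinset.2 ⟨z, hz, hlt⟩)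
    · exact Nat.lt_succ_of_le (Finset.le_sup (f := fun a : Set Z × Finset Γ × ℕ => a.2.2) ha)
    · intro γ hγ z hz
      have : z ∈ {z | ψ γ z < 1 / ((n : ℝ) + 1)} :=
        mem_iInter₂.1 (hUO hz) γ (Finset.mem_biUnion.2 ⟨a, ha, hγ⟩)
      exact (mem_ofPred.1 this).le)
  have hmono : StrictMono fun n => (f n).2.2 := fun m n hmn => (hfr m n hmn).1
  have hle : ∀ n, 1 / (((f n).2.2 : ℝ) + 1) ≤ 1 / ((n : ℝ) + 1) := fun n =>
    one_div_le_one_div_of_le (by positivity) (by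
      have : (n : ℝ) ≤ (f n).2.2 := by exact_mod_cast hmono.id_le n
      linarith)
  have hconv : ∀ γ, ∃ N, ∀ n > N, ∀ z ∈ (f n).1, ψ γ z ≤ 1 / ((n : ℝ) + 1) := by
    intro γ
    by_cases hγ : ∃ i, γ ∈ (f i).2.1
    · obtain ⟨i, hi⟩ := hγ
      exact ⟨i, fun n hn z hz => ((hfr i n hn).2 γ hi z hz).trans (hle n)⟩
    · push Not at hγ
      exact ⟨0, fun n _ z hz => ((hfP n).2.2 γ (hγ n) z hz).trans (hle n)⟩
  have hbump : ∀ n, ∃ x : X, ∃ g : C(Z, ℝ), EqOn g 0 ((f n).1)ᶜ ∧ g (e x) = 1 ∧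
      ∀ z, 0 ≤ g z := by
    intro n
    obtain ⟨x, hx⟩ := hd.exists_mem_open (hfP n).1 (hfP n).2.1
    obtain ⟨g, hg0, hg1, hg⟩ := exists_continuous_zero_one_of_isClosed
      (hfP n).1.isClosed_compl (isClosed_singleton (x := e x)) (by simpa using hx)
    exact ⟨x, g, hg0, hg1 rfl, fun z => (hg z).1⟩
  choose x g hg0 hg1 hgnn using hbump
  let G : ℕ → X → ℝ := fun n y => n * g n (e y)
  have hlf : LocallyFinite fun n => Function.support (G n) := by
    intro y
    obtain ⟨γ, m, hm⟩ := h.exists_lt_abs_sub (hp y)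
    obtain ⟨N, hN⟩ := hconv γ
    refine ⟨e ⁻¹' {z | 1 / ((m : ℝ) + 1) < ψ γ z},
      ((isOpen_lt continuous_const (hψ γ)).preimage he).mem_nhds hm,
      (finite_le_nat (max N m)).subset ?_⟩
    rintro n ⟨y', hy', hy''⟩
    by_contra! hn
    have hn : max N m < n := not_le.1 hn
    have hmem : e y' ∈ (f n).1 := by
      by_contra hnot
      exact hy' (by simp [G, hg0 n hnot])
    have h1 := hN n (lt_of_le_of_lt (le_max_left _ _) hn) _ hmem
    have h2 : 1 / ((n : ℝ) + 1) ≤ 1 / ((m : ℝ) + 1) :=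
      one_div_le_one_div_of_le (by positivity) (by
        have : (m : ℝ) ≤ n := by exact_mod_cast ((le_max_right N m).trans hn.le)
        linarith)
    exact absurd (h1.trans h2) (not_le.2 hy'')
  have hcont : Continuous fun y => ∑ᶠ n, G n y :=
    continuous_finsum (fun n => continuous_const.mul ((g n).continuous.comp he)) hlf
  obtain ⟨M, hM⟩ := hpc _ hcont
  obtain ⟨n, hn⟩ := exists_nat_gt M
  have hsupp : (Function.support fun i => G i (x n)).Finite := hlf.point_finite (x n)
  have h1 : G n (x n) ≤ ∑ᶠ i, G i (x n) :=
    single_le_finsum n hsupp fun i => mul_nonneg i.cast_nonneg (hgnn i _)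
  have h2 : G n (x n) = n := by simp [G, hg1]
  linarith [(le_abs_self _).trans (hM (x n))]

/-- `S` is closed under the countably-valued operation `o` on finite sets. -/
def ClosedUnder {T : Type*} (o : Finset T → Set T) (S : Set T) : Prop :=
  ∀ F : Finset T, (F : Set T) ⊆ S → o F ⊆ S

/-- The least set containing `S` which is closed under `o`. -/
def opHull {T : Type*} (o : Finset T → Set T) (S : Set T) : Set T :=
  ⋂₀ {R | ClosedUnder o R ∧ S ⊆ R}

section opHull

variable {T : Type*} {o : Finset T → Set T}

theorem subset_opHull (S : Set T) : S ⊆ opHull o S := subset_sInter fun _ hR => hR.2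

theorem opHull_subset {S R : Set T} (hR : ClosedUnder o R) (h : S ⊆ R) : opHull o S ⊆ R :=
  sInter_subset_of_mem ⟨hR, h⟩

theorem closedUnder_opHull (S : Set T) : ClosedUnder o (opHull o S) := fun F hF =>
  subset_sInter fun _ hR => hR.1 F (hF.trans (sInter_subset_of_mem hR))

theorem opHull_mono {S R : Set T} (h : S ⊆ R) : opHull o S ⊆ opHull o R :=
  opHull_subset (closedUnder_opHull R) (h.trans (subset_opHull R))

theorem ClosedUnder.iUnion_of_directed {ι : Type*} [Nonempty ι] {R : ι → Set T}
    (hd : Directed (· ⊆ ·) R) (h : ∀ i, ClosedUnder o (R i)) : ClosedUnder o (⋃ i, R i) := by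
  intro F hF
  obtain ⟨i, hi⟩ := hd.exists_mem_subset_of_finset_subset_biUnion hF
  exact (h i F hi).trans (subset_iUnion R i)

theorem countable_opHull (ho : ∀ F, (o F).Countable) {S : Set T} (hS : S.Countable) :
    (opHull o S).Countable := by
  let it : ℕ → Set T := fun n =>
    Nat.rec S (fun _ R => R ∪ ⋃ F ∈ {F : Finset T | (F : Set T) ⊆ R}, o F) n
  have hit : ∀ n, (it n).Countable := fun n => by
    induction n with
    | zero => exact hS
    | succ n ih =>
      have hfs : {F : Finset T | (F : Set T) ⊆ it n}.Countable :=
        ((countable_ofPred_finite_subset ih).preimage_of_injOn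
          (f := fun F : Finset T => (F : Set T)) Finset.coe_injective.injOn).mono
          fun F hF => mem_ofPred.2 ⟨F.finite_toSet, hF⟩
      exact ih.union (hfs.biUnion fun F _ => ho F)
  have hmono : Monotone it := monotone_nat_of_le_succ fun n => subset_union_left
  refine (countable_iUnion hit).mono (opHull_subset (fun F hF => ?_) (subset_iUnion it 0))
  obtain ⟨n, hn⟩ := hmono.directed_le.exists_mem_subset_of_finset_subset_biUnion hF
  refine Subset.trans ?_ (subset_iUnion it (n + 1))
  exact fun x hx => Or.inr (mem_iUnion₂.2 ⟨F, hn, hx⟩)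

theorem opHull_eq_iUnion_finset (S : Set T) :
    opHull o S = ⋃ F : {F : Finset T // (F : Set T) ⊆ S}, opHull o (F : Set T) := by
  classical
  refine Subset.antisymm (opHull_subset ?_ fun x hx => ?_) (iUnion_subset fun F => opHull_mono F.2)
  · have : Nonempty {F : Finset T // (F : Set T) ⊆ S} := ⟨⟨∅, by simp⟩⟩
    refine ClosedUnder.iUnion_of_directed (fun F G => ?_) fun F => closedUnder_opHull _
    refine ⟨⟨F.1 ∪ G.1, by simpa using ⟨F.2, G.2⟩⟩, opHull_mono ?_, opHull_mono ?_⟩ <;> simp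
  · exact mem_iUnion.2 ⟨⟨{x}, by simpa using hx⟩, subset_opHull _ (by simp)⟩

theorem mk_opHull_le (ho : ∀ F, (o F).Countable) (S : Set T) : #(opHull o S) ≤ max ℵ₀ #S := by
  classical
  have hsurj : Function.Surjective fun F : Finset S =>
      (⟨F.map (Function.Embedding.subtype _), by
        intro x hx; simp only [Finset.coe_map, mem_image] at hx; obtain ⟨y, -, rfl⟩ := hx
        exact y.2⟩ : {F : Finset T // (F : Set T) ⊆ S}) := by
    rintro ⟨F, hF⟩
    refine ⟨F.subtype (· ∈ S), Subtype.ext ?_⟩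
    exact Finset.subtype_map_of_mem fun x hx => hF hx
  have hfin : #{F : Finset T // (F : Set T) ⊆ S} ≤ max ℵ₀ #S := by
    refine (mk_le_of_surjective hsurj).trans ?_
    rcases finite_or_infinite S with h | h
    · exact (mk_le_aleph0 (α := Finset S)).trans (le_max_left _ _)
    · rw [mk_finset_of_infinite]; exact le_max_right _ _
  rw [opHull_eq_iUnion_finset]
  refine (mk_iUnion_le _).trans ((mul_le_mul' hfin (ciSup_le' fun F =>
    (countable_opHull ho F.1.countable_toSet).le_aleph0)).trans ?_)
  exact (mul_le_max _ _).trans (by simp)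

end opHull

/-- The sets `A` and `B` reflect the function `f` of two variables: each point is represented by a
point of `A` as far as `B` can tell, and vice versa. -/
structure IsReflectingPair {Z K : Type*} (f : Z → K → ℝ) (A : Set Z) (B : Set K) : Prop where
  left : ∀ x, ∃ a ∈ A, ∀ b ∈ B, f a b = f x b
  right : ∀ k, ∃ b ∈ B, ∀ a ∈ A, f a b = f a k

theorem exists_countable_finset_approx {Z K : Type*} (f : Z → K → ℝ) (F : Finset K) :
    ∃ C : Set Z, C.Countable ∧ ∀ x, ∀ ε > 0, ∃ a ∈ C, ∀ k ∈ F, |f a k - f x k| < ε := by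
  let g : Z → F → ℝ := fun z k => f z k
  let τ : TopologicalSpace Z := TopologicalSpace.induced g inferInstance
  have : SecondCountableTopology Z := TopologicalSpace.secondCountableTopology_induced _ _ g
  obtain ⟨C, hC, hCd⟩ := TopologicalSpace.exists_countable_dense Z
  refine ⟨C, hC, fun x ε hε => ?_⟩
  have hg : Continuous g := continuous_induced_dom
  obtain ⟨a, ha, haC⟩ := hCd.inter_open_nonempty _
    ((Metric.isOpen_ball (x := g x) (ε := ε)).preimage hg) ⟨x, Metric.mem_ball_self hε⟩
  refine ⟨a, haC, fun k hk => ?_⟩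
  have := (dist_pi_lt_iff hε).1 (Metric.mem_ball.1 ha) ⟨k, hk⟩
  rwa [Real.dist_eq] at this

theorem exists_mem_closure_forall_eq {Z K : Type*} [TopologicalSpace Z] [CompactSpace Z]
    [TopologicalSpace K] {f : Z → K → ℝ} (hfZ : ∀ k, Continuous fun z => f z k)
    (hfK : ∀ z, Continuous (f z)) {A : Set Z} {B : Set K}
    (h : ∀ F : Finset K, (F : Set K) ⊆ B → ∀ x, ∀ ε > 0, ∃ a ∈ A, ∀ k ∈ F, |f a k - f x k| < ε)
    (x : Z) : ∃ a ∈ closure A, ∀ b ∈ closure B, f a b = f x b := by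
  classical
  obtain ⟨a, ha, hax⟩ := (isClosed_closure (s := A)).isCompact.inter_iInter_nonempty
    (fun i : B × ℕ => {a | |f a i.1 - f x i.1| ≤ 1 / ((i.2 : ℝ) + 1)})
    (fun i => isClosed_le ((hfZ _).sub continuous_const).abs continuous_const) (by
      intro u
      obtain ⟨a, haA, ha⟩ := h (u.image fun i => (i.1 : K)) (by
        intro k hk
        obtain ⟨i, -, rfl⟩ := Finset.mem_image.1 (Finset.mem_coe.1 hk)
        exact i.1.2) x (1 / (((u.sup fun i => i.2 : ℕ) : ℝ) + 1)) Nat.one_div_pos_of_nat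
      refine ⟨a, subset_closure haA, mem_iInter₂.2 fun i hi => ?_⟩
      refine (ha i.1 (Finset.mem_image_of_mem _ hi)).le.trans ?_
      exact Nat.one_div_le_one_div (Finset.le_sup (f := fun i : B × ℕ => i.2) hi))
  have hB : ∀ b ∈ B, f a b = f x b := fun b hb => by
    by_contra hne
    obtain ⟨n, hn⟩ := exists_nat_one_div_lt (abs_pos.2 (sub_ne_zero.2 hne))
    exact absurd (mem_ofPred.1 (mem_iInter.1 hax (⟨b, hb⟩, n))) (not_le.2 hn)
  exact ⟨a, ha, fun b hb =>
    closure_minimal (t := {b | f a b = f x b}) hB (isClosed_eq (hfK a) (hfK x)) hb⟩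

theorem exists_op_isReflectingPair {Z K : Type*} [TopologicalSpace Z] [CompactSpace Z]
    [TopologicalSpace K] [CompactSpace K] {f : Z → K → ℝ} (hfZ : ∀ k, Continuous fun z => f z k)
    (hfK : ∀ z, Continuous (f z)) :
    ∃ o : Finset (Z ⊕ K) → Set (Z ⊕ K), (∀ F, (o F).Countable) ∧ ∀ S, ClosedUnder o S →
      IsReflectingPair f (closure (Sum.inl ⁻¹' S)) (closure (Sum.inr ⁻¹' S)) := by
  classical
  choose c hc hc' using exists_countable_finset_approx f
  choose d hd hd' using exists_countable_finset_approx fun k z => f z k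
  refine ⟨fun F => Sum.inl '' c F.toRight ∪ Sum.inr '' d F.toLeft,
    fun F => ((hc _).image _).union ((hd _).image _), fun S hS => ⟨?_, ?_⟩⟩
  · refine exists_mem_closure_forall_eq hfZ hfK fun F hF x ε hε => ?_
    obtain ⟨a, ha, ha'⟩ := hc' F x ε hε
    refine ⟨a, hS (F.map Function.Embedding.inr) ?_ (Or.inl ⟨a, ?_, rfl⟩), ha'⟩
    · intro t ht
      obtain ⟨k, hk, rfl⟩ := Finset.mem_map.1 (Finset.mem_coe.1 ht)
      exact hF hk
    · convert ha
      ext; simp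
  · refine exists_mem_closure_forall_eq (f := fun k z => f z k) hfK hfZ fun F hF x ε hε => ?_
    obtain ⟨a, ha, ha'⟩ := hd' F x ε hε
    refine ⟨a, hS (F.map Function.Embedding.inl) ?_ (Or.inr ⟨a, ?_, rfl⟩), ha'⟩
    · intro t ht
      obtain ⟨k, hk, rfl⟩ := Finset.mem_map.1 (Finset.mem_coe.1 ht)
      exact hF hk
    · convert ha
      ext; simp

namespace IsReflectingPair

variable {Z K : Type*} {f : Z → K → ℝ} {A : Set Z} {B : Set K}

theorem eq_of_forall_eq (h : IsReflectingPair f A B)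
    (hsep : ∀ x y, (∀ k, f x k = f y k) → x = y) {x y : Z} (hx : x ∈ A) (hy : y ∈ A)
    (hxy : ∀ b ∈ B, f x b = f y b) : x = y := by
  refine hsep x y fun k => ?_
  obtain ⟨b, hb, hbk⟩ := h.right k
  rw [← hbk x hx, ← hbk y hy, hxy b hb]

theorem exists_continuous_retraction [TopologicalSpace Z] [CompactSpace Z]
    (h : IsReflectingPair f A B) (hsep : ∀ x y, (∀ k, f x k = f y k) → x = y)
    (hfZ : ∀ k, Continuous fun z => f z k) (hA : IsClosed A) :
    ∃ r : Z → A, Continuous r ∧ ∀ x, ∀ b ∈ B, f (r x) b = f x b := by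
  have hex : ∀ x, ∃ a : A, ∀ b ∈ B, f a b = f x b := fun x => by
    obtain ⟨a, ha, hax⟩ := h.left x
    exact ⟨⟨a, ha⟩, hax⟩
  choose r hr using hex
  refine ⟨r, continuous_iff_isClosed.2 fun C hC => ?_, hr⟩
  have : CompactSpace A := isCompact_iff_compactSpace.1 hA.isCompact
  have hG : IsClosed (Prod.fst ⁻¹' C ∩ ⋂ b ∈ B, {q : A × Z | f q.1 b = f q.2 b}) :=
    (hC.preimage continuous_fst).inter <| isClosed_biInter fun b _ => isClosed_eq
      ((hfZ b).comp (continuous_subtype_val.comp continuous_fst)) ((hfZ b).comp continuous_snd)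
  convert isClosedMap_snd_of_compactSpace _ hG
  ext x
  constructor
  · exact fun hx => ⟨(r x, x), ⟨hx, mem_iInter₂.2 (hr x)⟩, rfl⟩
  · rintro ⟨⟨a, y⟩, ⟨haC, ha⟩, rfl⟩
    have : r y = a := Subtype.ext (h.eq_of_forall_eq hsep (r y).2 a.2 fun b hb => by
      rw [hr y b hb]; exact (mem_iInter₂.1 ha b hb).symm)
    change r y ∈ C
    rwa [this]

theorem abs_sub_le_of_forall (h : IsReflectingPair f A B) {x y x' y' : Z} (hx' : x' ∈ A)
    (hy' : y' ∈ A) (hx : ∀ b ∈ B, f x' b = f x b) (hy : ∀ b ∈ B, f y' b = f y b) {c : ℝ}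
    (hc : ∀ k, |f x k - f y k| ≤ c) (k : K) : |f x' k - f y' k| ≤ c := by
  obtain ⟨b, hb, hbk⟩ := h.right k
  rw [← hbk x' hx', ← hbk y' hy', hx b hb, hy b hb]
  exact hc b

/-- Along an increasing sequence of reflecting pairs, the retracts of a point `x` form a uniformly
Cauchy sequence. -/
theorem exists_forall_abs_sub_le {Z K : Type*} [TopologicalSpace Z] [TopologicalSpace K]
    [CompactSpace K] {f : Z → K → ℝ} (hfZ : ∀ k, Continuous fun z => f z k)
    (hfK : ∀ z, Continuous (f z)) {A A' : ℕ → Set Z}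
    {B B' : ℕ → Set K} {Aω : Set Z} {Bω : Set K}
    (h : ∀ n, IsReflectingPair f (A n) (B n)) (h' : ∀ n, IsReflectingPair f (A' n) (B' n))
    (hω : IsReflectingPair f (closure Aω) Bω) (hBω : IsClosed Bω)
    (hAA' : ∀ n, A n ⊆ A' n) (hA'A : ∀ m n, m < n → A' m ⊆ A n) (hBB' : ∀ n, B n ⊆ B' n)
    (hAω : Aω ⊆ ⋃ n, A n) (hB'ω : ∀ n, B' n ⊆ Bω) {x : Z} {a a' : ℕ → Z}
    (ha : ∀ n, a n ∈ A n) (ha' : ∀ n, a' n ∈ A' n) (hax : ∀ n, ∀ b ∈ B n, f (a n) b = f x b)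
    (hax' : ∀ n, ∀ b ∈ B' n, f (a' n) b = f x b) {ε : ℝ} (hε : 0 < ε) :
    ∃ n, ∀ k, |f (a' n) k - f (a n) k| ≤ ε := by
  by_contra! hcon
  choose k hk using hcon
  choose k' hk'B hk' using fun n => (h' n).right (k n)
  choose k'' hk''B hk'' using fun n => (h n).right (k n)
  let 𝓤 : Ultrafilter ℕ := Filter.hyperfilter ℕ
  have h𝓤 : (𝓤 : Filter ℕ) ≤ Filter.atTop := by
    rw [← Nat.cofinite_eq_atTop]; exact Filter.hyperfilter_le_cofinite
  obtain ⟨l', -, hl'⟩ := isCompact_univ.ultrafilter_le_nhds (𝓤.map k') (by simp)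
  obtain ⟨l'', -, hl''⟩ := isCompact_univ.ultrafilter_le_nhds (𝓤.map k'') (by simp)
  have ht' : Filter.Tendsto k' 𝓤 (𝓝 l') := hl'
  have ht'' : Filter.Tendsto k'' 𝓤 (𝓝 l'') := hl''
  have hl'B : l' ∈ Bω := hBω.mem_of_tendsto ht'
    (Filter.Eventually.of_forall fun n => hB'ω n (hk'B n))
  have hl''B : l'' ∈ Bω := hBω.mem_of_tendsto ht''
    (Filter.Eventually.of_forall fun n => hB'ω n (hBB' n (hk''B n)))
  have heqA : ∀ z ∈ Aω, f z l' = f z l'' := by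
    intro z hz
    obtain ⟨m, hm⟩ := mem_iUnion.1 (hAω hz)
    have hz' : Filter.Tendsto (fun n => f z (k' n)) 𝓤 (𝓝 (f z l')) :=
      ((hfK z).tendsto l').comp ht'
    have hz'' : Filter.Tendsto (fun n => f z (k'' n)) 𝓤 (𝓝 (f z l'')) :=
      ((hfK z).tendsto l'').comp ht''
    refine tendsto_nhds_unique_of_eventuallyEq hz' hz'' ?_
    filter_upwards [h𝓤 (Filter.eventually_gt_atTop m)] with n hn
    have hzn : z ∈ A n := hA'A m n hn (hAA' m hm)
    rw [hk' n z (hAA' n hzn), hk'' n z hzn]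
  have heq : ∀ z ∈ closure Aω, f z l' = f z l'' := fun z hz =>
    closure_minimal (t := {z | f z l' = f z l''}) heqA (isClosed_eq (hfZ l') (hfZ l'')) hz
  obtain ⟨w, hw, hwx⟩ := hω.left x
  have hxl : f x l' = f x l'' := by rw [← hwx _ hl'B, ← hwx _ hl''B, heq w hw]
  have hlim : Filter.Tendsto (fun n => |f x (k' n) - f x (k'' n)|) 𝓤 (𝓝 |f x l' - f x l''|) :=
    ((((hfK x).tendsto l').comp ht').sub (((hfK x).tendsto l'').comp ht'')).abs
  have hle : ε ≤ |f x l' - f x l''| := by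
    refine ge_of_tendsto hlim (Filter.Eventually.of_forall fun n => ?_)
    have h1 := (hk n).le
    rwa [← hk' n _ (ha' n), ← hk'' n _ (ha n), hax' n _ (hk'B n), hax n _ (hk''B n)] at h1
  rw [hxl, _root_.sub_self, abs_zero] at hle
  linarith

end IsReflectingPair

/-- There is a continuous injection `φ` of `Z` into `c₀(Γ)` which is `1`-Lipschitz with respect to
the uniform distance of the functions `f z`. -/
def HasLipschitzC0Injection {Z K : Type u} [TopologicalSpace Z] (f : Z → K → ℝ) : Prop :=
  ∃ (Γ : Type u) (φ : Γ → Z → ℝ), IsC0Injection φ ∧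
    ∀ γ x y c, 0 ≤ c → (∀ k, |f x k - f y k| ≤ c) → |φ γ x - φ γ y| ≤ c

theorem hasLipschitzC0Injection_of_countable {Z K : Type u} [TopologicalSpace Z] [CompactSpace Z]
    [TopologicalSpace K] [CompactSpace K] {f : Z → K → ℝ} (hfZ : ∀ k, Continuous fun z => f z k)
    (hfK : ∀ z, Continuous (f z)) (hsep : ∀ x y, (∀ k, f x k = f y k) → x = y) {D : Set Z}
    (hD : Dense D) (hDc : D.Countable) : HasLipschitzC0Injection f := by
  obtain ⟨o, hoc, ho⟩ := exists_op_isReflectingPair hfZ hfK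
  let S := opHull o (Sum.inl '' D)
  have hS : S.Countable := countable_opHull hoc (hDc.image _)
  let B : Set K := Sum.inr ⁻¹' S
  have hB : B.Countable := hS.preimage Sum.inr_injective
  have hgood := ho S (closedUnder_opHull _)
  have hcl : closure (Sum.inl ⁻¹' S) = (Set.univ : Set Z) := by
    refine (hD.mono fun z hz => ?_).closure_eq
    exact subset_opHull (o := o) _ (mem_image_of_mem Sum.inl hz)
  have := hB.to_subtype
  obtain ⟨enc, henc⟩ := exists_injective_nat B
  refine ⟨B, fun b z => f z b / ((enc b : ℝ) + 1),
    ⟨fun b => (hfZ b).div_const _, fun x ε hε => ?_, fun x y hxy => ?_⟩, ?_⟩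
  · obtain ⟨M, hM⟩ := (isCompact_range (hfK x)).isBounded.exists_norm_le
    obtain ⟨N, hN⟩ := exists_nat_gt (M / ε)
    refine ((finite_lt_nat N).preimage henc.injOn).subset fun b hb => ?_
    have hpos : (0 : ℝ) < (enc b : ℝ) + 1 := by positivity
    have hb' : ε < |f x b / ((enc b : ℝ) + 1)| := hb
    rw [abs_div, abs_of_pos hpos, lt_div_iff₀ hpos] at hb'
    have h1 : |f x b| ≤ M := hM _ ⟨b, rfl⟩
    rw [div_lt_iff₀ hε] at hN
    have h2 : ε * (enc b : ℝ) < ε * N := by nlinarith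
    exact mem_ofPred.2 (by exact_mod_cast lt_of_mul_lt_mul_left h2 hε.le)
  · refine hgood.eq_of_forall_eq hsep (hcl ▸ mem_univ x) (hcl ▸ mem_univ y) fun b hb => ?_
    refine closure_minimal (t := {b | f x b = f y b}) (fun b hb => ?_)
      (isClosed_eq (hfK x) (hfK y)) hb
    have := hxy ⟨b, hb⟩
    have hpos : (enc ⟨b, hb⟩ : ℝ) + 1 ≠ 0 := by positivity
    exact (div_left_inj' hpos).1 this
  · intro b x y c hc hxy
    have hpos : (0 : ℝ) < (enc b : ℝ) + 1 := by positivity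
    rw [← sub_div, abs_div, abs_of_pos hpos, div_le_iff₀ hpos]
    have h0 : (0 : ℝ) ≤ enc b := by positivity
    nlinarith [hxy b]

/-- Amir–Lindenstrauss theorem for a compact space of continuous functions on a compact space. -/
theorem hasLipschitzC0Injection {K : Type u} [TopologicalSpace K] [CompactSpace K]
    (κ : Cardinal.{u}) : ∀ {Z : Type u} [TopologicalSpace Z] [CompactSpace Z] {f : Z → K → ℝ},
    (∀ k, Continuous fun z => f z k) → (∀ z, Continuous (f z)) →
    (∀ x y, (∀ k, f x k = f y k) → x = y) → ∀ {D : Set Z}, Dense D → #D = κ →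
    HasLipschitzC0Injection f := by
  classical
  induction κ using WellFoundedLT.induction with
  | ind κ ih =>
  intro Z _ _ f hfZ hfK hsep D hD hDκ
  rcases le_or_gt κ ℵ₀ with hκ | hκ
  · exact hasLipschitzC0Injection_of_countable hfZ hfK hsep hD
      (le_aleph0_iff_set_countable.1 (hDκ.trans_le hκ))
  obtain ⟨o, hoc, ho⟩ := exists_op_isReflectingPair hfZ hfK
  let ι : Type u := κ.ord.ToType
  have hι : #ι = κ := mk_ord_toType κ
  obtain ⟨z⟩ : Nonempty (ι ≃ D) := Cardinal.eq.1 (hι.trans hDκ.symm)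
  let H : Set ι → Set (Z ⊕ K) := fun R => opHull o (Sum.inl '' ((fun i => (z i : Z)) '' R))
  have hHmono : ∀ {R R'}, R ⊆ R' → H R ⊆ H R' := fun h => opHull_mono (image_mono (image_mono h))
  let A : Set ι → Set Z := fun R => closure (Sum.inl ⁻¹' H R)
  let B : Set ι → Set K := fun R => closure (Sum.inr ⁻¹' H R)
  have hAmono : ∀ {R R'}, R ⊆ R' → A R ⊆ A R' := fun h => closure_mono (preimage_mono (hHmono h))
  have hBmono : ∀ {R R'}, R ⊆ R' → B R ⊆ B R' := fun h => closure_mono (preimage_mono (hHmono h))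
  have hgood : ∀ R, IsReflectingPair f (A R) (B R) := fun R => ho _ (closedUnder_opHull _)
  have hAu : A Set.univ = Set.univ := by
    refine (hD.mono fun w hw => ?_).closure_eq
    exact subset_opHull (o := o) _ (mem_image_of_mem Sum.inl
      ⟨z.symm ⟨w, hw⟩, trivial, by simp⟩)
  have hret : ∀ R, ∃ r : Z → A R, Continuous r ∧ ∀ x, ∀ b ∈ B R, f (r x) b = f x b := fun R =>
    (hgood R).exists_continuous_retraction hsep hfZ isClosed_closure
  choose r hrc hr using hret
  have hrLip : ∀ R {x y : Z} {c : ℝ}, (∀ k, |f x k - f y k| ≤ c) →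
      ∀ k, |f (r R x) k - f (r R y) k| ≤ c := fun R x y c hxy k =>
    (hgood R).abs_sub_le_of_forall (r R x).2 (r R y).2 (hr R x) (hr R y) hxy k
  have hsmall : ∀ (R : Set ι), #R < κ → HasLipschitzC0Injection fun (a : A R) k => f a k := by
    intro R hR
    have : CompactSpace (A R) :=
      isCompact_iff_compactSpace.1 (isClosed_closure (s := Sum.inl ⁻¹' H R)).isCompact
    let E : Set (A R) := Subtype.val ⁻¹' (Sum.inl ⁻¹' H R)
    have hE : Dense E := by
      refine Subtype.dense_iff.2 fun w hw => ?_
      rwa [Subtype.image_preimage_coe, inter_eq_right.2 subset_closure]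
    have hEκ : #E < κ := by
      have h1 : #E ≤ #(H R) := mk_le_of_injective
        (f := fun e : E => (⟨Sum.inl (e : A R), e.2⟩ : H R)) fun e e' hee' => by
          simpa [Subtype.ext_iff] using hee'
      have h2 : #(H R) ≤ max ℵ₀ #R := by
        refine (mk_opHull_le hoc _).trans (max_le_max le_rfl ?_)
        exact mk_image_le.trans mk_image_le
      exact (h1.trans h2).trans_lt (max_lt hκ hR)
    exact ih #E hEκ (fun k => (hfZ k).comp continuous_subtype_val) (fun a => hfK a)
      (fun a a' h => Subtype.ext (hsep _ _ h)) hE rfl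
  obtain ⟨Γb, φ₀, hφ₀, hφ₀L⟩ := hsmall ∅ (by simpa using aleph0_pos.trans hκ)
  have hIic : ∀ i : ι, #(Iic i) < κ := fun i => by
    have h1 : Iic i = insert i (Iio i) := by ext; simp [le_iff_eq_or_lt]
    rw [h1]
    exact (mk_insert_le).trans_lt
      (add_lt_of_lt hκ.le ((mk_Iio_lt i (by rw [hι]; simp [ι])).trans_eq hι)
        (one_lt_aleph0.trans hκ))
  choose Γ φ hφ hφL using fun i => hsmall (Iic i) (hIic i)
  let j : ∀ i, A (Iio i) → A (Iic i) := fun i => inclusion (hAmono Iio_subset_Iic_self)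
  let Φ : Γb ⊕ (Σ i, Γ i) → Z → ℝ := Sum.elim (fun γ x => φ₀ γ (r ∅ x))
    (fun p x => (φ p.1 p.2 (r (Iic p.1) x) - φ p.1 p.2 (j p.1 (r (Iio p.1) x))) / 2)
  have hΦle : ∀ i (γ : Γ i) x c, 0 ≤ c → (∀ k, |f (r (Iic i) x) k - f (r (Iio i) x) k| ≤ c) →
      |Φ (Sum.inr ⟨i, γ⟩) x| ≤ c := by
    intro i γ x c hc hx
    have h1 := hφL i γ (r (Iic i) x) (j i (r (Iio i) x)) c hc hx
    simp only [Φ, Sum.elim_inr, abs_div, abs_two]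
    linarith
  have hbig : ∀ x, ∀ ε > 0,
      {i | ¬ ∀ k, |f (r (Iic i) x) k - f (r (Iio i) x) k| ≤ ε}.Finite := by
    intro x ε hε
    by_contra hinf
    have : Infinite {i | ¬ ∀ k, |f (r (Iic i) x) k - f (r (Iio i) x) k| ≤ ε} :=
      (not_finite.1 hinf).to_subtype
    obtain ⟨s, hs | hs⟩ := Infinite.exists_strictMono_or_strictAnti
      {i | ¬ ∀ k, |f (r (Iic i) x) k - f (r (Iio i) x) k| ≤ ε}
    · have hlt : ∀ {m n}, m < n → (s m : ι) < s n := fun h => hs h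
      have hdir : Directed (· ⊆ ·) fun n => H (Iio (s n : ι)) :=
        (monotone_nat_of_le_succ fun n =>
          hHmono (Iio_subset_Iio (hlt n.lt_succ_self).le)).directed_le
      have hstep : ∀ {m n}, m < n → Iic (s m : ι) ⊆ Iio (s n : ι) := fun h i hi =>
        lt_of_le_of_lt hi (hlt h)
      obtain ⟨n, hn⟩ := IsReflectingPair.exists_forall_abs_sub_le hfZ hfK
        (fun n => hgood (Iio (s n : ι))) (fun n => hgood (Iic (s n : ι)))
        (ho _ (ClosedUnder.iUnion_of_directed hdir fun n => closedUnder_opHull _))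
        isClosed_closure (fun n => hAmono Iio_subset_Iic_self)
        (fun m n hmn => hAmono (hstep hmn)) (fun n => hBmono Iio_subset_Iic_self)
        (by
          rw [preimage_iUnion]
          exact iUnion_mono fun n => subset_closure)
        (fun n => closure_mono (preimage_mono ((hHmono (hstep n.lt_succ_self)).trans
          (subset_iUnion (fun n => H (Iio (s n : ι))) (n + 1)))))
        (fun n => (r (Iio (s n : ι)) x).2) (fun n => (r (Iic (s n : ι)) x).2)
        (fun n => hr _ x) (fun n => hr _ x) hε
      exact (s n).2 hn
    · exact (RelEmbedding.natGT s fun n => hs n.lt_succ_self).not_wellFounded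
        (wellFounded_lt)
  refine ⟨Γb ⊕ (Σ i, Γ i), Φ, ⟨?_, fun x ε hε => ?_, fun x y hxy => ?_⟩, ?_⟩
  · rintro (γ | ⟨i, γ⟩)
    · exact (hφ₀.continuous γ).comp (hrc ∅)
    · exact (((hφ i).continuous γ).comp (hrc _) |>.sub (((hφ i).continuous γ).comp
        ((continuous_inclusion (hAmono Iio_subset_Iic_self)).comp (hrc _)))).div_const 2
  · have hfin : (⋃ i ∈ {i | ¬ ∀ k, |f (r (Iic i) x) k - f (r (Iio i) x) k| ≤ ε},
        (fun γ : Γ i => (Sum.inr ⟨i, γ⟩ : Γb ⊕ (Σ i, Γ i))) ''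
          {γ | ε < |φ i γ (r (Iic i) x) - φ i γ (j i (r (Iio i) x))|}).Finite :=
      (hbig x ε hε).biUnion fun i _ => ((hφ i).finite_sub _ _ hε).image _
    refine (((hφ₀.finite (r ∅ x) ε hε).image Sum.inl).union hfin).subset ?_
    rintro (γ | ⟨i, γ⟩) hγ
    · exact Or.inl ⟨γ, hγ, rfl⟩
    · refine Or.inr (mem_iUnion₂.2 ⟨i, fun hi => ?_, γ, ?_, rfl⟩)
      · exact absurd (hΦle i γ x ε hε.le hi) (not_le.2 hγ)
      · have hγ' : ε < |(φ i γ (r (Iic i) x) - φ i γ (j i (r (Iio i) x))) / 2| := hγ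
        rw [abs_div, abs_two] at hγ'
        exact mem_ofPred.2 (by linarith)
  · have hBagree : ∀ R, r R x = r R y → ∀ b ∈ B R, f x b = f y b := fun R hR b hb => by
      rw [← hr R x b hb, hR, hr R y b hb]
    have h0 : r ∅ x = r ∅ y := hφ₀.separates _ _ fun γ => hxy (Sum.inl γ)
    have hclosure : ∀ R, (∀ i ∈ R, ∀ b ∈ B (Iic i), f x b = f y b) → ∀ b ∈ B R, f x b = f y b := by
      intro R hR b hb
      refine closure_minimal (t := {b | f x b = f y b}) (fun b hb => ?_)
        (isClosed_eq (hfK x) (hfK y)) hb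
      have hb' : Sum.inr b ∈ opHull o (Sum.inl '' ((fun i => (z i : Z)) '' R)) := hb
      rw [← image_comp, opHull_eq_iUnion_finset] at hb'
      obtain ⟨⟨F, hF⟩, hbF⟩ := mem_iUnion.1 hb'
      obtain ⟨G, hGR, rfl⟩ := Finset.subset_set_image_iff.1 hF
      have hbG : Sum.inr b ∈ H (G : Set ι) := by
        simpa only [H, ← image_comp, Finset.coe_image] using hbF
      rcases G.eq_empty_or_nonempty with rfl | hG
      · exact hBagree ∅ h0 b (subset_closure (by simpa using hbG))
      · exact hR _ (hGR (G.max'_mem hG)) b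
          (subset_closure (hHmono (fun i hi => G.le_max' i hi) hbG))
    have hall : ∀ i, r (Iic i) x = r (Iic i) y := by
      intro i
      induction i using WellFoundedLT.induction with
      | ind i IH =>
      have hlt : r (Iio i) x = r (Iio i) y := by
        refine Subtype.ext ((hgood (Iio i)).eq_of_forall_eq hsep (r _ x).2 (r _ y).2 fun b hb => ?_)
        rw [hr _ x b hb, hr _ y b hb]
        exact hclosure (Iio i) (fun i' hi' => hBagree _ (IH i' hi')) b hb
      refine (hφ i).separates _ _ fun γ => ?_
      have h1 : (φ i γ (r (Iic i) x) - φ i γ (j i (r (Iio i) x))) / 2 =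
        (φ i γ (r (Iic i) y) - φ i γ (j i (r (Iio i) y))) / 2 := hxy (Sum.inr ⟨i, γ⟩)
      rw [hlt] at h1
      linarith
    exact (hgood Set.univ).eq_of_forall_eq hsep (hAu ▸ mem_univ x) (hAu ▸ mem_univ y)
      (hclosure Set.univ fun i _ => hBagree _ (hall i))
  · rintro (γ | ⟨i, γ⟩) x y c hc hxy
    · exact hφ₀L γ _ _ c hc (hrLip ∅ hxy)
    · have h1 := hφL i γ _ _ c hc (hrLip (Iic i) hxy)
      have h2 := hφL i γ (j i (r (Iio i) x)) (j i (r (Iio i) y)) c hc (hrLip (Iio i) hxy)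
      simp only [Φ, Sum.elim_inr]
      rw [abs_le] at h1 h2 ⊢
      constructor <;> linarith [h1.1, h1.2, h2.1, h2.2]

/-- Every Eberlein–Grothendieck pseudocompact scattered space is σ-discrete. -/
theorem sigmaDiscrete_of_EG_pseudocompact_scattered
    (X : Type u) [TopologicalSpace X]
    (hEG : EberleinGrothendieck X) (hpc : Pseudocompact X) (hsc : IsScattered X) :
    IsSigmaDiscrete X := by
  obtain ⟨K, _, _, _, f, hf⟩ := hEG
  let e : X → K → ℝ := fun x => (f x).1
  have he : IsEmbedding e := IsEmbedding.subtypeVal.comp hf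
  have hev : ∀ k, Continuous fun x => e x k := fun k => (continuous_apply k).comp he.continuous
  choose M hM using fun k => hpc _ (hev k)
  let Z : Set (K → ℝ) := closure (range e)
  have hZ : IsCompact Z := by
    refine (isCompact_univ_pi fun k => isCompact_Icc (a := -M k) (b := M k)).of_isClosed_subset
      isClosed_closure (closure_minimal ?_ (isClosed_set_pi fun k _ => isClosed_Icc))
    rintro _ ⟨x, rfl⟩ k -
    exact abs_le.1 (hM k x)
  have : CompactSpace Z := isCompact_iff_compactSpace.1 hZ
  obtain ⟨Γ, φ, hφ, -⟩ := hasLipschitzC0Injection (#(Set.univ : Set Z))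
    (f := fun (z : Z) k => z.1 k) (fun k => (continuous_apply k).comp continuous_subtype_val)
    (fun z => hpc.continuous_of_mem_closure he.continuous (fun x => (f x).2) z.2)
    (fun z w h => Subtype.ext (funext h)) dense_univ rfl
  let e' : X → Z := fun x => ⟨e x, subset_closure ⟨x, rfl⟩⟩
  have he' : IsEmbedding e' := he.codRestrict Z _
  have hd : DenseRange e' := by
    refine Subtype.dense_iff.2 fun z hz => ?_
    rwa [← range_comp]
  have hsurj := hφ.surjective_of_denseRange hpc he'.continuous hd
  let E : X ≃ₜ Z := he'.toHomeomorphOfSurjective hsurj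
  have : CompactSpace X := E.symm.compactSpace
  have : T2Space X := he'.t2Space
  have hφX : IsC0Injection fun γ x => φ γ (e' x) :=
    ⟨fun γ => (hφ.continuous γ).comp he'.continuous, fun x => hφ.finite (e' x),
      fun x y h => he'.injective (hφ.separates _ _ h)⟩
  exact (hφX.sigmaDiscreteOn_univ hsc).isSigmaDiscrete
end
end

section
/- Every Eberlein–Grothendieck space of cardinality ω₁ is hereditarily meta-Lindelöf; in fact, every such space embeds into C_p(L) for some compact Hausdorff space L of weight at most ω₁. -/
open Set Topology Ordinal Cardinal

noncomputable section
universe u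

/-- A continuous function on a compact space that is constant on the common fibres of a family of
continuous functions is a uniform limit of rational polynomials in that family. -/
theorem exists_mvPolynomial_near {K Y : Type*} [TopologicalSpace K] [CompactSpace K]
    (d : Y → C(K, ℝ)) (S : Set Y) (f : C(K, ℝ))
    (hf : ∀ s t, (∀ y ∈ S, d y s = d y t) → f s = f t) {ε : ℝ} (hε : 0 < ε) :
    ∃ p : MvPolynomial Y ℚ, ↑p.vars ⊆ S ∧
      ∀ k, |f k - MvPolynomial.aeval (fun y => d y k) p| < ε := by
  classical
  let q : K → S → ℝ := fun k y => d y k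
  have hq : Continuous q := continuous_pi fun y => (d y).continuous
  have : CompactSpace (range q) := isCompact_iff_compactSpace.mp (isCompact_range hq)
  let r : C(K, range q) := ⟨rangeFactorization q, hq.subtype_mk _⟩
  have hr : IsQuotientMap r :=
    r.continuous.isClosedMap.isQuotientMap r.continuous rangeFactorization_surjective
  have hfac : Function.FactorsThrough f r := fun s t hst =>
    hf s t fun y hy => congrFun (congrArg Subtype.val hst) ⟨y, hy⟩
  let g : C(range q, ℝ) := hr.lift f hfac
  have hg : ∀ k, g (r k) = f k := fun k => DFunLike.congr_fun (hr.lift_comp f hfac) k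
  let c : S → C(range q, ℝ) := fun y =>
    ⟨fun l => l.1 y, (continuous_apply y).comp continuous_subtype_val⟩
  let φ : MvPolynomial S ℚ →ₐ[ℚ] C(range q, ℝ) := MvPolynomial.aeval c
  have hsep : (Algebra.adjoin ℝ (range c)).SeparatesPoints := by
    intro l m hlm
    obtain ⟨y, hy⟩ : ∃ y, l.1 y ≠ m.1 y := by
      by_contra! h
      exact hlm (Subtype.ext (funext h))
    exact ⟨c y, ⟨c y, Algebra.subset_adjoin ⟨y, rfl⟩, rfl⟩, hy⟩
  have hdense : ∀ a ∈ Algebra.adjoin ℝ (range c), a ∈ φ.range.topologicalClosure := by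
    intro a ha
    induction ha using Algebra.adjoin_induction with
    | mem x hx =>
      obtain ⟨y, rfl⟩ := hx
      exact Subalgebra.le_topologicalClosure _ ⟨MvPolynomial.X y, MvPolynomial.aeval_X c y⟩
    | algebraMap x =>
      refine map_mem_closure (continuous_algebraMap ℝ C(range q, ℝ)) (Rat.denseRange_cast x) ?_
      rintro _ ⟨z, rfl⟩
      exact ⟨MvPolynomial.C z, by ext; simp [φ]⟩
    | add x y _ _ hx hy => exact add_mem hx hy
    | mul x y _ _ hx hy => exact mul_mem hx hy
  obtain ⟨⟨a, ha⟩, hag⟩ := ContinuousMap.exists_mem_subalgebra_near_continuousMap_of_separatesPoints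
    _ hsep g (ε / 2) (half_pos hε)
  obtain ⟨_, ⟨p, rfl⟩, hp⟩ := Metric.mem_closure_iff.mp (hdense a ha) (ε / 2) (half_pos hε)
  refine ⟨MvPolynomial.rename Subtype.val p, ?_, fun k => ?_⟩
  · intro y hy
    obtain ⟨z, -, rfl⟩ := Finset.mem_image.mp (MvPolynomial.vars_rename _ _ hy)
    exact z.2
  · have hev : MvPolynomial.aeval (fun y => d y k) (MvPolynomial.rename Subtype.val p) =
        φ p (r k) := by
      rw [MvPolynomial.aeval_rename]
      exact (MvPolynomial.comp_aeval_apply c (ContinuousMap.evalAlgHom ℚ ℝ (r k)) p).symm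
    have hdist : dist g (φ p) < ε := by
      have : dist g a < ε / 2 := by rwa [dist_comm, dist_eq_norm]
      exact (dist_triangle g a (φ p)).trans_lt ((add_lt_add this hp).trans_eq (add_halves ε))
    rw [hev, ← hg, ← Real.dist_eq]
    exact (ContinuousMap.dist_apply_le_dist _).trans_lt hdist

/-- Pointwise neighbourhoods contain uniform balls. -/
theorem exists_uniform_ball_subset {Y K : Type*} [TopologicalSpace Y] {d : Y → K → ℝ}
    (hd : IsInducing d) {U : Set Y} (hU : IsOpen U) {x : Y} (hx : x ∈ U) :
    ∃ ε > 0, ∀ y, (∀ k, |d y k - d x k| < ε) → y ∈ U := by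
  obtain ⟨V, hV, rfl⟩ := hd.isOpen_iff.mp hU
  obtain ⟨I, u, hu, huV⟩ := isOpen_pi_iff.mp hV (d x) hx
  have h : ∀ᶠ ε in 𝓝[>] (0 : ℝ), ∀ k ∈ I, Metric.ball (d x k) ε ⊆ u k := by
    rw [Filter.eventually_all_finset]
    intro k hk
    obtain ⟨ε, hε, hεu⟩ := Metric.isOpen_iff.mp (hu k hk).1 _ (hu k hk).2
    filter_upwards [Ioo_mem_nhdsGT hε] with δ hδ
    exact (Metric.ball_subset_ball hδ.2.le).trans hεu
  obtain ⟨ε, hεu, hε⟩ := (h.and self_mem_nhdsWithin).exists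
  exact ⟨ε, hε, fun y hy => huV fun k hk => hεu k hk (hy k)⟩

/-- A set of cardinality at most `ℵ₁` has a well-order with countable initial segments. -/
theorem exists_wellOrder_countable_Iic {Y : Type*} (hY : #Y ≤ ℵ₁) :
    ∃ (_ : LinearOrder Y) (_ : WellFoundedLT Y), ∀ x : Y, (Iic x).Countable := by
  obtain ⟨_, _, h⟩ := exists_ord_eq_type_lt Y
  refine ⟨inferInstance, inferInstance, fun x => ?_⟩
  rw [← Iio_insert]
  refine (le_aleph0_iff_set_countable.mp ?_).insert x
  rw [← Order.lt_succ_iff, succ_aleph0]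
  exact (mk_Iio_lt x h).trans_le hY

/-- A space of cardinality at most `ℵ₁` that carries the topology of pointwise convergence of
continuous functions on a compact space is meta-Lindelöf. -/
theorem isMetaLindelof_of_isInducing {Y K : Type u} [TopologicalSpace Y] [TopologicalSpace K]
    [CompactSpace K] (d : Y → C(K, ℝ)) (hd : IsInducing fun y k => d y k) (hY : #Y ≤ ℵ₁) :
    IsMetaLindelof Y := by
  classical
  intro 𝒰 h𝒰 hcov
  obtain ⟨_, _, hIic⟩ := exists_wellOrder_countable_Iic hY
  let B : MvPolynomial Y ℚ × ℕ → Set Y := fun p =>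
    {y | ∀ k, |d y k - MvPolynomial.aeval (fun z => d z k) p.1| < 1 / (p.2 + 1 : ℝ)}
  let S : MvPolynomial Y ℚ → Set Y := fun p => {y | ∃ z ∈ p.vars, y < z}
  let R : MvPolynomial Y ℚ → Set Y := fun p =>
    {x | p.vars.Nonempty ∧ ∀ s t, (∀ y ∈ S p, d y s = d y t) → d x s = d x t}
  have hd_cont : ∀ k, Continuous fun y => d y k := fun k => (continuous_apply k).comp hd.continuous
  have hR : ∀ p, IsClosed (R p) := by
    intro p
    refine isClosed_const.and ?_
    simp only [ofPred_forall]
    exact isClosed_iInter fun s => isClosed_iInter fun t => isClosed_iInter fun _ =>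
      isClosed_eq (hd_cont s) (hd_cont t)
  let G : Set (MvPolynomial Y ℚ × ℕ) := {p | ∃ U ∈ 𝒰, B p ⊆ U}
  have hG : ∀ p : G, ∃ U ∈ 𝒰, B p ⊆ U := fun p => p.2
  choose u hu𝒰 hBu using hG
  let V : G → Set Y := fun p => u p \ R p.1.1
  -- a point has good approximations by polynomials in any family of coordinates determining it
  have happrox : ∀ x, ∃ n : ℕ, ∀ T : Set Y,
      (∀ s t, (∀ y ∈ T, d y s = d y t) → d x s = d x t) →
      ∃ p : MvPolynomial Y ℚ, ↑p.vars ⊆ T ∧ (p, n) ∈ G ∧ x ∈ B (p, n) := by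
    intro x
    obtain ⟨U, hU, hxU⟩ : ∃ U ∈ 𝒰, x ∈ U := mem_sUnion.mp (hcov ▸ mem_univ x)
    obtain ⟨ε, hε, hεU⟩ := exists_uniform_ball_subset hd (h𝒰 U hU) hxU
    obtain ⟨n, hn⟩ := exists_nat_one_div_lt (half_pos hε)
    refine ⟨n, fun T hT => ?_⟩
    obtain ⟨p, hpT, hp⟩ := exists_mvPolynomial_near d T (d x) hT
      (Nat.one_div_pos_of_nat (α := ℝ) (n := n))
    refine ⟨p, hpT, ⟨U, hU, fun y hy => hεU y fun k => ?_⟩, hp⟩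
    have h₁ := abs_lt.mp (hy k)
    have h₂ := abs_lt.mp (hp k)
    dsimp only at h₁
    rw [abs_lt]
    constructor <;> linarith
  refine ⟨range V, ?_, ?_, ?_, ?_⟩
  · rintro _ ⟨p, rfl⟩
    exact (h𝒰 _ (hu𝒰 p)).sdiff (hR _)
  · rw [eq_univ_iff_forall]
    intro x
    obtain ⟨n, hn⟩ := happrox x
    let P : Set (MvPolynomial Y ℚ) := {p | (p, n) ∈ G ∧ x ∈ B (p, n)}
    have hP : P.Nonempty := by
      obtain ⟨p, -, hp⟩ := hn univ fun s t h => h x (mem_univ x)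
      exact ⟨p, hp⟩
    obtain ⟨p, hpP, hmin⟩ := (InvImage.wf (fun p => p.vars.max) wellFounded_lt).has_min P hP
    refine ⟨_, ⟨⟨(p, n), hpP.1⟩, rfl⟩, hBu ⟨(p, n), hpP.1⟩ hpP.2, fun hxR => ?_⟩
    obtain ⟨p', hp'S, hp'⟩ := hn _ hxR.2
    refine hmin p' hp' ?_
    obtain ⟨w, hw⟩ := Finset.max_of_nonempty hxR.1
    change p'.vars.max < p.vars.max
    rw [hw]
    refine (Finset.sup_lt_iff (WithBot.bot_lt_coe w)).mpr fun y hy => ?_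
    obtain ⟨z, hz, hyz⟩ := hp'S hy
    exact WithBot.coe_lt_coe.mpr (hyz.trans_le (Finset.le_max_of_eq hz hw))
  · rintro _ ⟨p, rfl⟩
    exact ⟨u p, hu𝒰 p, sdiff_subset⟩
  · intro x
    have hc : (MvPolynomial.supported ℚ (Iic x) : Set (MvPolynomial Y ℚ)).Countable := by
      have := (hIic x).to_subtype
      have : Countable (MvPolynomial (Iic x) ℚ) := by
        rw [← mk_le_aleph0_iff]
        exact MvPolynomial.cardinalMk_le_max_lift.trans (by simp)
      exact (MvPolynomial.supportedEquivMvPolynomial (R := ℚ) (Iic x)).injective.countable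
    refine (((hc.prod (countable_univ (α := ℕ))).preimage
      (Subtype.val_injective (p := (· ∈ G)))).image V).mono ?_
    rintro _ ⟨⟨p, rfl⟩, hxV⟩
    refine ⟨p, ⟨?_, mem_univ _⟩, rfl⟩
    refine MvPolynomial.mem_supported.mpr fun z hz => ?_
    by_contra hlt
    exact hxV.2 ⟨⟨z, hz⟩, fun s t h => h x ⟨z, hz, not_le.mp hlt⟩⟩

/-- A subspace of a product of at most `ℵ₁` real lines has weight at most `ℵ₁`. -/
theorem tweight_subtype_pi_real_le {X : Type u} (hX : #X ≤ ℵ₁) (L : Set (X → ℝ)) :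
    tweight L ≤ ℵ₁ := by
  classical
  let T : Set (Set ℝ) := TopologicalSpace.countableBasis ℝ
  have hT : Countable T := (TopologicalSpace.countable_countableBasis ℝ).to_subtype
  let g : Finset (X × T) → Set (X → ℝ) := fun F => {l | ∀ p ∈ F, l p.1 ∈ p.2.1}
  have hbasis := isTopologicalBasis_pi
    fun _ : X => TopologicalSpace.isBasis_countableBasis ℝ
  have hsub : {S : Set (X → ℝ) | ∃ (U : X → Set ℝ) (F : Finset X), (∀ i ∈ F, U i ∈ T) ∧
      S = (F : Set X).pi U} ⊆ range g := by
    rintro _ ⟨U, F, hU, rfl⟩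
    refine ⟨F.attach.image fun i : F => (i.1, ⟨U i, hU i i.2⟩), ?_⟩
    ext l
    have : (∀ i, ∀ t ∈ T, i ∈ F → U i = t → l i ∈ t) ↔ ∀ i ∈ F, l i ∈ U i :=
      ⟨fun h i hi => h i _ (hU i hi) hi rfl, fun h i t _ hi hit => hit ▸ h i hi⟩
    simpa [g, Set.mem_pi] using this
  have hcard : #(Finset (X × T)) ≤ ℵ₁ := by
    have hXT : #(X × T) ≤ ℵ₁ := by
      have hTc : lift.{u} #T ≤ ℵ₁ :=
        (lift_le_aleph0.mpr (mk_le_aleph0_iff.mpr hT)).trans aleph0_lt_aleph_one.le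
      rw [mk_prod, Cardinal.lift_uzero]
      exact (mul_le_mul' (by simpa using hX) hTc).trans_eq (mul_eq_self (aleph0_le_aleph 1))
    cases finite_or_infinite (X × T)
    · exact (mk_le_aleph0_iff.mpr inferInstance).trans aleph0_lt_aleph_one.le
    · rwa [mk_finset_of_infinite]
  have hL := hbasis.isInducing (IsInducing.subtypeVal (t := L))
  exact (csInf_le' ⟨_, hL, rfl⟩ : tweight L ≤ _).trans <|
    mk_image_le.trans <| (mk_le_mk_of_subset hsub).trans <| mk_range_le.trans hcard

/-- Every Eberlein–Grothendieck space of cardinality `ω₁` is hereditarily meta-Lindelöf;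
in fact, every such space embeds into `C_p(L)` for some compact Hausdorff space `L` of
weight at most `ω₁`. -/
theorem heredMetaLindelof_of_EG_card_aleph1
    (X : Type u) [TopologicalSpace X]
    (hEG : EberleinGrothendieck X) (hcard : #X = Cardinal.aleph 1) :
    HereditarilyMetaLindelof X ∧
      ∃ (L : Type u) (_ : TopologicalSpace L), CompactSpace L ∧ T2Space L ∧
        tweight L ≤ Cardinal.aleph 1 ∧
        ∃ f : X → {g : L → ℝ // Continuous g}, IsEmbedding f := by
  obtain ⟨K, _, _, _, f, hf⟩ := hEG
  have hd : IsEmbedding fun x => (f x).1 := IsEmbedding.subtypeVal.comp hf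
  refine ⟨fun S => isMetaLindelof_of_isInducing (fun x : S => ⟨(f x).1, (f x).2⟩)
    (hd.isInducing.comp IsInducing.subtypeVal) ((mk_set_le S).trans hcard.le), ?_⟩
  let q : K → X → ℝ := fun k x => (f x).1 k
  have hq : Continuous q := continuous_pi fun x => (f x).2
  refine ⟨range q, inferInstance, isCompact_iff_compactSpace.mp (isCompact_range hq),
    inferInstance, tweight_subtype_pi_real_le hcard.le _,
    fun x => ⟨fun l => l.1 x, (continuous_apply x).comp continuous_subtype_val⟩, ?_⟩
  have hrestrict : Continuous fun (h : {g : range q → ℝ // Continuous g}) k => h.1 ⟨q k, k, rfl⟩ :=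
    continuous_pi fun k => (continuous_apply _).comp continuous_subtype_val
  refine IsEmbedding.of_comp (Continuous.subtype_mk (continuous_pi ?_) _) hrestrict hd
  rintro ⟨_, k, rfl⟩
  exact (continuous_apply k).comp hd.continuous
end
end

section
/- Every scattered Eberlein compact space is σ-discrete; more precisely, if K is a scattered Eberlein compact space then K embeds into {0,1}^Γ for some set Γ so that every point of K has finite support, and consequently K is the countable union of the discrete subspaces X_n = {x ∈ K : |supp(x)| = n}, n ∈ ω. -/
open Set Topology Ordinal Cardinal

noncomputable section
universe u

/-- `HasScatteredRankLE o x` says that `x` has an open neighbourhood all of whose other points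
have scattered rank at most some ordinal below `o`. -/
inductive HasScatteredRankLE {X : Type u} [TopologicalSpace X] : Ordinal.{u} → X → Prop
  | mk (o : Ordinal.{u}) (x : X) (W : Set X) (b : X → Ordinal.{u}) (hW : IsOpen W) (hx : x ∈ W)
      (hb : ∀ z ∈ W, z ≠ x → b z < o)
      (h : ∀ z ∈ W, z ≠ x → HasScatteredRankLE (b z) z) : HasScatteredRankLE o x

theorem IsScattered.exists_hasScatteredRankLE {X : Type u} [TopologicalSpace X]
    (h : IsScattered X) (x : X) : ∃ o, HasScatteredRankLE o x := by
  by_contra hx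
  obtain ⟨y, hy, W, hW, hWS⟩ := h {x | ¬ ∃ o, HasScatteredRankLE o x} ⟨x, hx⟩
  have hyW : y ∈ W := by
    have : y ∈ W ∩ {x | ¬ ∃ o, HasScatteredRankLE o x} := by rw [hWS]; rfl
    exact this.1
  have key : ∀ z : X, ∃ o, z ∈ W → z ≠ y → HasScatteredRankLE o z := by
    intro z
    by_cases hz : ∃ o, HasScatteredRankLE o z
    · exact hz.imp fun o ho _ _ => ho
    · refine ⟨0, fun hzW hzy => (hzy ?_).elim⟩
      have : z ∈ W ∩ {x | ¬ ∃ o, HasScatteredRankLE o x} := ⟨hzW, hz⟩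
      rwa [hWS] at this
  choose b hb using key
  refine hy ⟨Order.succ (⨆ z, b z), .mk _ _ W b hW hyW (fun z _ _ => ?_) hb⟩
  exact Order.lt_succ_iff.2 (Ordinal.le_iSup b z)

theorem IsScattered.totallyDisconnectedSpace {X : Type*} [TopologicalSpace X] [T1Space X]
    (h : IsScattered X) : TotallyDisconnectedSpace X := by
  refine ⟨fun S _ hS => ?_⟩
  rcases S.eq_empty_or_nonempty with rfl | hne
  · exact subsingleton_empty
  obtain ⟨x, hx, W, hW, hWS⟩ := h S hne
  have hxW : x ∈ W := (hWS.ge rfl : x ∈ W ∩ S).1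
  suffices hsub : S ⊆ {x} from subsingleton_singleton.anti hsub
  by_contra hsub
  obtain ⟨y, hy, hyx⟩ := not_subset.1 hsub
  obtain ⟨z, hzS, hzW, hzx⟩ := hS W {x}ᶜ hW isOpen_compl_singleton
    (fun z _ => (em (z = x)).imp (fun e : z = x => e ▸ hxW) id) ⟨x, hx, hxW⟩ ⟨y, hy, hyx⟩
  exact hzx (hWS.le ⟨hzW, hzS⟩)

/-- A choice, for every point `x` of a space, of a clopen neighbourhood of `x` in which `x` is the
unique point of largest rank. -/
structure RankedNhds (X : Type u) [TopologicalSpace X] where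
  /-- The neighbourhood of a point. -/
  nhd : X → Set X
  /-- The rank of a point. -/
  rank : X → Ordinal.{u}
  isClopen_nhd : ∀ x, IsClopen (nhd x)
  mem_nhd : ∀ x, x ∈ nhd x
  rank_lt : ∀ {x z}, z ∈ nhd x → z ≠ x → rank z < rank x

theorem IsScattered.nonempty_rankedNhds {X : Type u} [TopologicalSpace X] [CompactSpace X]
    [T2Space X] (h : IsScattered X) : Nonempty (RankedNhds X) := by
  have := h.totallyDisconnectedSpace
  let rank : X → Ordinal.{u} := fun x => sInf {o | HasScatteredRankLE o x}
  have key : ∀ x, ∃ C : Set X, IsClopen C ∧ x ∈ C ∧ ∀ z ∈ C, z ≠ x → rank z < rank x := by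
    intro x
    have hx : HasScatteredRankLE (rank x) x := csInf_mem (h.exists_hasScatteredRankLE x)
    obtain ⟨_, _, W, b, hW, hxW, hb, hlt⟩ := hx
    obtain ⟨C, hC, hxC, hCW⟩ := compact_exists_isClopen_in_isOpen hW hxW
    exact ⟨C, hC, hxC, fun z hz hzx =>
      (show rank z ≤ b z from csInf_le' (hlt z (hCW hz) hzx)).trans_lt (hb z (hCW hz) hzx)⟩
  choose C hC hxC hlt using key
  exact ⟨⟨C, rank, hC, hxC, fun {x z} hz hzx => hlt x z hz hzx⟩⟩

/-- A family of clopen sets that is point-finite on `P` and separates the points of `C ∩ P`. -/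
structure IsStrongFamily {X : Type*} [TopologicalSpace X] (P C : Set X) (𝒱 : Set (Set X)) :
    Prop where
  isClopen : ∀ V ∈ 𝒱, IsClopen V
  finite : ∀ x ∈ P, {V ∈ 𝒱 | x ∈ V}.Finite
  separates : ∀ x ∈ C ∩ P, ∀ y ∈ C ∩ P, (∀ V ∈ 𝒱, x ∈ V ↔ y ∈ V) → x = y

theorem exists_isStrongFamily_of_cover {X : Type*} [TopologicalSpace X] {P C : Set X}
    (N : ℕ → Set X) (hN : ∀ n, IsClopen (N n))
    (hs : ∀ n, ∃ 𝒱, IsStrongFamily P (N n) 𝒱) (hC : ((C ∩ P) \ ⋃ n, N n).Subsingleton) :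
    ∃ 𝒱, IsStrongFamily P C 𝒱 := by
  choose 𝒱 h𝒱 using hs
  have hD : ∀ n, IsClopen (disjointed N n) := fun n =>
    disjointedRec (p := IsClopen) (fun t i ht => ht.diff (hN i)) (hN n)
  have huniq : ∀ {x m n}, x ∈ disjointed N m → x ∈ disjointed N n → m = n := by
    intro x m n hm hn
    by_contra hmn
    exact disjoint_left.1 (disjoint_disjointed N hmn) hm hn
  let D : ℕ → Set (Set X) := fun n => insert (disjointed N n) ((disjointed N n ∩ ·) '' 𝒱 n)
  refine ⟨⋃ n, D n, ?_, ?_, ?_⟩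
  · rintro V hV
    obtain ⟨n, hV⟩ := mem_iUnion.1 hV
    rcases hV with rfl | ⟨V, hV', rfl⟩
    · exact hD n
    · exact (hD n).inter ((h𝒱 n).isClopen V hV')
  · intro x hx
    by_cases hxN : ∃ n, x ∈ disjointed N n
    · obtain ⟨n, hn⟩ := hxN
      refine ((((h𝒱 n).finite x hx).image (disjointed N n ∩ ·)).insert (disjointed N n)).subset ?_
      rintro V ⟨hV, hxV⟩
      obtain ⟨m, hV⟩ := mem_iUnion.1 hV
      rcases hV with rfl | ⟨V, hV', rfl⟩
      · exact .inl (by rw [huniq hxV hn])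
      · obtain rfl := huniq hxV.1 hn
        exact .inr ⟨V, ⟨hV', hxV.2⟩, rfl⟩
    · convert finite_empty
      rw [eq_empty_iff_forall_notMem]
      rintro V ⟨hV, hxV⟩
      obtain ⟨m, hV⟩ := mem_iUnion.1 hV
      rcases hV with rfl | ⟨V, hV', rfl⟩
      · exact hxN ⟨m, hxV⟩
      · exact hxN ⟨m, hxV.1⟩
  · intro x hx y hy hxy
    have hiff : ∀ n, x ∈ disjointed N n ↔ y ∈ disjointed N n := fun n =>
      hxy _ (mem_iUnion.2 ⟨n, .inl rfl⟩)
    by_cases hxN : ∃ n, x ∈ disjointed N n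
    · obtain ⟨n, hn⟩ := hxN
      have hn' := (hiff n).1 hn
      refine (h𝒱 n).separates x ⟨disjointed_subset N n hn, hx.2⟩ y
        ⟨disjointed_subset N n hn', hy.2⟩ fun V hV => ?_
      have := hxy _ (mem_iUnion.2 ⟨n, .inr ⟨V, hV, rfl⟩⟩)
      simpa [hn, hn'] using this
    · have hyN : ¬ ∃ n, y ∈ disjointed N n := by simpa only [← hiff] using hxN
      rw [← mem_iUnion, iUnion_disjointed] at hxN hyN
      exact hC ⟨hx, hxN⟩ ⟨hy, hyN⟩

theorem isStrongFamily_empty {X : Type*} [TopologicalSpace X] (P : Set X) :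
    IsStrongFamily P ∅ ∅ :=
  ⟨by simp, by simp, by simp⟩

namespace RankedNhds

variable {K : Type u} [TopologicalSpace K]

theorem exists_isStrongFamily_of_countable (R : RankedNhds K) {P : Set K} (hP : P.Countable) :
    ∃ 𝒱, IsStrongFamily P univ 𝒱 := by
  rcases P.eq_empty_or_nonempty with rfl | hne
  · exact ⟨∅, by simp, by simp, by simp⟩
  obtain ⟨e, rfl⟩ := hP.exists_eq_range hne
  have key : ∀ o : Ordinal.{u}, ∀ x, R.rank x = o →
      ∃ 𝒱, IsStrongFamily (range e) (R.nhd x) 𝒱 := by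
    intro o
    induction o using WellFoundedLT.induction with
    | ind o ih =>
      rintro x rfl
      classical
      let N : ℕ → Set K := fun n => if R.rank (e n) < R.rank x then R.nhd (e n) else ∅
      refine exists_isStrongFamily_of_cover N (fun n => ?_) (fun n => ?_) ?_
      · by_cases h : R.rank (e n) < R.rank x
        · simpa [N, h] using R.isClopen_nhd (e n)
        · simp [N, h, isClopen_empty]
      · by_cases h : R.rank (e n) < R.rank x
        · simpa [N, h] using ih _ h (e n) rfl
        · simpa [N, h] using ⟨∅, isStrongFamily_empty _⟩
      · refine (subsingleton_singleton (a := x)).anti ?_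
        rintro _ ⟨⟨hy, n, rfl⟩, hn⟩
        by_contra hne
        refine hn (mem_iUnion.2 ⟨n, ?_⟩)
        simpa [N, R.rank_lt hy hne] using R.mem_nhd (e n)
  refine exists_isStrongFamily_of_cover (fun n => R.nhd (e n)) (fun n => R.isClopen_nhd _)
    (fun n => key _ _ rfl) ?_
  rintro _ ⟨⟨-, n, rfl⟩, hn⟩
  exact (hn (mem_iUnion.2 ⟨n, R.mem_nhd _⟩)).elim

variable (R : RankedNhds K)

/-- Two points are equivalent over `P` if they lie in the same neighbourhoods of points of `P`. -/
def Equiv (P : Set K) (x y : K) : Prop := ∀ p ∈ P, x ∈ R.nhd p ↔ y ∈ R.nhd p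

variable {R}

theorem Equiv.symm {P : Set K} {x y : K} (h : R.Equiv P x y) : R.Equiv P y x :=
  fun p hp => (h p hp).symm

theorem Equiv.trans {P : Set K} {x y z : K} (h : R.Equiv P x y) (h' : R.Equiv P y z) :
    R.Equiv P x z :=
  fun p hp => (h p hp).trans (h' p hp)

theorem Equiv.mono {P Q : Set K} {x y : K} (h : R.Equiv Q x y) (hPQ : P ⊆ Q) : R.Equiv P x y :=
  fun p hp => h p (hPQ hp)

theorem Equiv.eq {P : Set K} {x y : K} (h : R.Equiv P x y) (hx : x ∈ P) (hy : y ∈ P) : x = y := by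
  by_contra hne
  exact lt_asymm (R.rank_lt ((h x hx).1 (R.mem_nhd x)) (Ne.symm hne))
    (R.rank_lt ((h y hy).2 (R.mem_nhd y)) hne)

theorem isClopen_setOf_mem_nhd_iff {Y : Type*} [TopologicalSpace Y] {f g : Y → K}
    (hf : Continuous f) (hg : Continuous g) (p : K) :
    IsClopen {y | f y ∈ R.nhd p ↔ g y ∈ R.nhd p} := by
  have h1 := (R.isClopen_nhd p).preimage hf
  have h2 := (R.isClopen_nhd p).preimage hg
  convert (h1.inter h2).union (h1.compl.inter h2.compl) using 1
  ext y
  simp only [mem_ofPred_eq, mem_union, mem_inter_iff, mem_preimage, mem_compl_iff]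
  tauto

variable (R)

theorem exists_finset_nhd_cover [CompactSpace K] (F : Finset K) :
    ∃ G : Finset K, ∀ x, ∃ t ∈ G, x ∈ R.nhd t ∧ R.Equiv F x t := by
  let O : K → Set K := fun t => R.nhd t ∩ ⋂ p ∈ F, {x | x ∈ R.nhd p ↔ t ∈ R.nhd p}
  have hO : ∀ t, IsOpen (O t) := fun t => (R.isClopen_nhd t).isOpen.inter <|
    isOpen_biInter_finset fun p _ =>
      (isClopen_setOf_mem_nhd_iff continuous_id continuous_const p).isOpen
  obtain ⟨G, hG⟩ := isCompact_univ.elim_finite_subcover O hO fun t _ =>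
    mem_iUnion.2 ⟨t, R.mem_nhd t, by simp⟩
  refine ⟨G, fun x => ?_⟩
  obtain ⟨t, ht, hx⟩ := mem_iUnion₂.1 (hG (mem_univ x))
  exact ⟨t, ht, hx.1, fun p hp => by simpa using mem_iInter₂.1 hx.2 p hp⟩

theorem exists_countable_equiv_imp_eq [CompactSpace K] {g : K → ℝ} (hg : Continuous g) :
    ∃ S : Set K, S.Countable ∧ ∀ x y, R.Equiv S x y → g x = g y := by
  have key : ∀ n : ℕ, ∃ S : Finset K, ∀ x y, R.Equiv S x y → |g x - g y| < 1 / (n + 1 : ℝ) := by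
    intro n
    let D : Set (K × K) := {z | 1 / (n + 1 : ℝ) ≤ |g z.1 - g z.2|}
    have hD : IsCompact D := (isClosed_le continuous_const (by fun_prop)).isCompact
    let O : K → Set (K × K) := fun p => {z | z.1 ∈ R.nhd p ↔ z.2 ∈ R.nhd p}ᶜ
    obtain ⟨S, hS⟩ := hD.elim_finite_subcover O
      (fun p => (isClopen_setOf_mem_nhd_iff continuous_fst continuous_snd p).compl.isOpen) (by
        rintro ⟨x, y⟩ hxy
        by_contra hn
        have hE : R.Equiv univ x y := fun p _ => by
          by_contra hp
          exact hn (mem_iUnion.2 ⟨p, hp⟩)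
        obtain rfl := hE.eq (mem_univ _) (mem_univ _)
        have : 1 / (n + 1 : ℝ) ≤ 0 := by simpa [D] using hxy
        exact absurd this (not_le.2 (by positivity)))
    refine ⟨S, fun x y hxy => ?_⟩
    by_contra hn
    obtain ⟨p, hp, hxp⟩ := mem_iUnion₂.1 (hS (show (x, y) ∈ D from not_lt.1 hn))
    exact hxp (hxy p hp)
  choose S hS using key
  refine ⟨⋃ n, S n, countable_iUnion fun n => (S n).countable_toSet, fun x y hxy => ?_⟩
  by_contra hne
  obtain ⟨n, hn⟩ := exists_nat_one_div_lt (abs_pos.2 (sub_ne_zero.2 hne))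
  exact lt_asymm hn (hS n x y (hxy.mono (subset_iUnion (fun n => (S n : Set K)) n)))

end RankedNhds

/-- A set is closed under a countable family of finitary operations `φ`. -/
def IsClosedUnder {K : Type*} (φ : Finset K → ℕ → K) (P : Set K) : Prop :=
  ∀ F : Finset K, ↑F ⊆ P → ∀ n, φ F n ∈ P

theorem IsClosedUnder.iUnion_of_directed {K ι : Type*} [Nonempty ι] {φ : Finset K → ℕ → K}
    {P : ι → Set K} (hP : ∀ i, IsClosedUnder φ (P i)) (hd : Directed (· ⊆ ·) P) :
    IsClosedUnder φ (⋃ i, P i) := by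
  intro F hF n
  obtain ⟨i, hi⟩ := hd.exists_mem_subset_of_finset_subset_biUnion hF
  exact mem_iUnion.2 ⟨i, hP i F hi n⟩

/-- The smallest set containing `S` and closed under `φ`. -/
def closedHull {K : Type*} (φ : Finset K → ℕ → K) (S : Set K) : Set K :=
  ⋂₀ {P | IsClosedUnder φ P ∧ S ⊆ P}

section ClosedHull

variable {K : Type u} {φ : Finset K → ℕ → K} {S T P : Set K}

theorem subset_closedHull : S ⊆ closedHull φ S := subset_sInter fun _ h => h.2

theorem closedHull_subset (hP : IsClosedUnder φ P) (h : S ⊆ P) : closedHull φ S ⊆ P :=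
  sInter_subset_of_mem ⟨hP, h⟩

theorem isClosedUnder_closedHull : IsClosedUnder φ (closedHull φ S) :=
  fun F hF n _ hQ => hQ.1 F (hF.trans (sInter_subset_of_mem hQ)) n

theorem closedHull_mono (h : S ⊆ T) : closedHull φ S ⊆ closedHull φ T :=
  closedHull_subset isClosedUnder_closedHull (h.trans subset_closedHull)

/-- The first-order language with countably many function symbols of each arity. -/
def countableFunctionLanguage : FirstOrder.Language.{0, 0} := ⟨fun _ => ℕ, fun _ => Empty⟩

theorem mk_closedHull_le : #(closedHull φ S) ≤ max ℵ₀ #S := by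
  classical
  let L := countableFunctionLanguage
  let _ : L.Structure K :=
    { funMap := fun {n} k v => φ (Finset.univ.image v) k
      RelMap := fun {n} k => k.elim }
  let H := FirstOrder.Language.Substructure.closure L S
  have hH : IsClosedUnder φ (H : Set K) := by
    intro F hF n
    have := H.fun_mem (n := F.card) (show L.Functions F.card from n)
      (fun i => (F.equivFin.symm i : K)) (fun i => hF (F.equivFin.symm i).2)
    have himg : Finset.univ.image (fun i => (F.equivFin.symm i : K)) = F := by
      ext x
      simp only [Finset.mem_image, Finset.mem_univ, true_and]
      exact ⟨fun ⟨i, hi⟩ => hi ▸ (F.equivFin.symm i).2, fun hx => ⟨F.equivFin ⟨x, hx⟩, by simp⟩⟩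
    change φ (Finset.univ.image (fun i => (F.equivFin.symm i : K))) n ∈ H at this
    rwa [himg] at this
  have hle := FirstOrder.Language.Substructure.lift_card_closure_le (L := L) (s := S)
  have hL : #(Σ i, L.Functions i) ≤ ℵ₀ :=
    Cardinal.mk_le_aleph0_iff.2 (inferInstanceAs (Countable (Σ _ : ℕ, ℕ)))
  have hL' : Cardinal.lift.{u} #(Σ i, L.Functions i) ≤ ℵ₀ :=
    Cardinal.lift_le_aleph0.2 hL
  calc #(closedHull φ S) ≤ #H :=
        Cardinal.mk_le_mk_of_subset
          (closedHull_subset hH FirstOrder.Language.Substructure.subset_closure)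
    _ ≤ max ℵ₀ (#S + ℵ₀) := by
        simpa using hle.trans (max_le_max le_rfl (add_le_add le_rfl hL'))
    _ ≤ max ℵ₀ #S := by
        rw [max_comm ℵ₀ #S, Cardinal.add_eq_max' le_rfl]
        simp

end ClosedHull

/-- Let `f` be separately continuous on `K × Y` with `Y` compact. If on finite subsets of `P` every
`f · y` can be approximated by some `f · q` with `q ∈ Q`, then any two points of `closure P` that are
not separated by `Q` are not separated by `Y`. -/
theorem eq_on_of_separatelyContinuous {K Y : Type*} [TopologicalSpace K] [TopologicalSpace Y]
    [CompactSpace Y] {f : K → Y → ℝ} (hK : ∀ y, Continuous fun x => f x y)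
    (hY : ∀ x, Continuous (f x)) {P : Set K} {Q : Set Y}
    (hQ : ∀ F : Finset K, ↑F ⊆ P → ∀ y, ∀ ε > 0, ∃ q ∈ Q, ∀ p ∈ F, |f p q - f p y| ≤ ε)
    {x z : K} (hx : x ∈ closure P) (hz : z ∈ closure P) (hxz : ∀ q ∈ Q, f x q = f z q) (y : Y) :
    f x y = f z y := by
  obtain ⟨q, hqQ, hq⟩ : ∃ q ∈ closure Q, ∀ p ∈ P, f p q = f p y := by
    let C : (P × {ε : ℝ // 0 < ε}) → Set Y := fun i => {q | |f i.1 q - f i.1 y| ≤ i.2}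
    have hC : ∀ i, IsClosed (C i) := fun i =>
      isClosed_le (((hY _).sub continuous_const).abs) continuous_const
    obtain ⟨q, hq, hqC⟩ := isClosed_closure.isCompact.inter_iInter_nonempty (s := closure Q) C hC
      (by
        classical
        intro u
        obtain ⟨ε, hε, hεu⟩ : ∃ ε > 0, ∀ i ∈ u, ε ≤ (i.2 : ℝ) := by
          rcases u.eq_empty_or_nonempty with rfl | hu
          · exact ⟨1, one_pos, by simp⟩
          · obtain ⟨j, -, hj⟩ := u.exists_min_image (fun i => (i.2 : ℝ)) hu
            exact ⟨j.2, j.2.2, hj⟩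
        obtain ⟨q, hq, hqF⟩ := hQ (u.image fun i => (i.1 : K)) (by
          intro p hp
          obtain ⟨i, -, rfl⟩ := Finset.mem_image.1 (Finset.mem_coe.1 hp)
          exact i.1.2) y ε hε
        exact ⟨q, subset_closure hq, mem_iInter₂.2 fun i hi =>
          (hqF i.1 (Finset.mem_image_of_mem _ hi)).trans (hεu i hi)⟩)
    refine ⟨q, hq, fun p hp => ?_⟩
    by_contra hne
    have h0 : 0 < |f p q - f p y| := abs_pos.2 (sub_ne_zero.2 hne)
    have : |f p q - f p y| ≤ |f p q - f p y| / 2 :=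
      mem_iInter.1 hqC (⟨p, hp⟩, ⟨_, half_pos h0⟩)
    linarith
  have hcl : ∀ w ∈ closure P, f w q = f w y := fun w hw =>
    closure_minimal (show P ⊆ {w | f w q = f w y} from hq) (isClosed_eq (hK q) (hK y)) hw
  have hxzq : f x q = f z q :=
    closure_minimal (show Q ⊆ {q | f x q = f z q} from hxz) (isClosed_eq (hY x) (hY z)) hqQ
  rw [← hcl x hx, ← hcl z hz, hxzq]

theorem exists_countable_approximating {K Y : Type*} (f : K → Y → ℝ) (F : Finset K) :
    ∃ Q : Set Y, Q.Countable ∧ ∀ y, ∀ ε > 0, ∃ q ∈ Q, ∀ p ∈ F, |f p q - f p y| ≤ ε := by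
  let ρ : Y → F → ℝ := fun y p => f p y
  obtain ⟨D, hD, hDd⟩ := TopologicalSpace.exists_countable_dense (range ρ)
  choose g hg using fun d : range ρ => d.2
  refine ⟨g '' D, hD.image g, fun y ε hε => ?_⟩
  obtain ⟨d, hd, hdist⟩ := Metric.dense_iff.1 hDd ⟨ρ y, y, rfl⟩ ε hε
  refine ⟨g d, ⟨d, hdist, rfl⟩, fun p hp => ?_⟩
  have h1 : dist (ρ (g d)) (ρ y) < ε := by rw [hg]; exact hd
  have h2 := (dist_le_pi_dist (ρ (g d)) (ρ y) ⟨p, hp⟩).trans h1.le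
  rwa [Real.dist_eq] at h2

namespace RankedNhds

variable {K : Type u} [TopologicalSpace K] {R : RankedNhds K}

theorem exists_mem_equiv {P : Set K}
    (hP : ∀ F : Finset K, ↑F ⊆ P → ∀ x, ∃ t ∈ P, x ∈ R.nhd t ∧ R.Equiv F x t) (x : K) :
    ∃ t ∈ P, R.Equiv P x t := by
  classical
  obtain ⟨t₀, ht₀, hxt₀, -⟩ := hP ∅ (by simp) x
  obtain ⟨t, ⟨ht, hxt⟩, hmin⟩ := (InvImage.wf R.rank wellFounded_lt).has_min
    {t | t ∈ P ∧ x ∈ R.nhd t} ⟨t₀, ht₀, hxt₀⟩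
  refine ⟨t, ht, fun p hp => ?_⟩
  obtain ⟨s, hs, hxs, hE⟩ := hP {t, p} (by simp [Set.insert_subset_iff, ht, hp]) x
  have hst : s = t := by
    by_contra hne
    exact hmin s ⟨hs, hxs⟩ (R.rank_lt ((hE t (by simp)).1 hxt) hne)
  exact hst ▸ hE p (by simp)

/-- The map `r` sends every point to an equivalent point of `P`, continuously. -/
structure IsRetraction (R : RankedNhds K) (P : Set K) (r : K → K) : Prop where
  continuous : Continuous r
  mem : ∀ x, r x ∈ P
  equiv : ∀ x, R.Equiv P x (r x)

theorem IsRetraction.eq {P : Set K} {r : K → K} (hr : R.IsRetraction P r) {x t : K}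
    (ht : t ∈ P) (h : R.Equiv P x t) : r x = t :=
  ((hr.equiv x).symm.trans h).eq (hr.mem x) ht

theorem IsRetraction.apply_of_mem {P : Set K} {r : K → K} (hr : R.IsRetraction P r) {x : K}
    (hx : x ∈ P) : r x = x :=
  hr.eq hx fun _ _ => Iff.rfl

theorem IsRetraction.comp {P Q : Set K} {r s : K → K} (hr : R.IsRetraction P r)
    (hs : R.IsRetraction Q s) (hPQ : P ⊆ Q) (x : K) : r (s x) = r x :=
  hr.eq (hr.mem x) (((hs.equiv x).mono hPQ).symm.trans (hr.equiv x))

theorem exists_isRetraction [CompactSpace K] {P : Set K}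
    (hP : ∀ x, ∃ t ∈ P, R.Equiv P x t)
    (hcl : ∀ x ∈ closure P, ∀ y ∈ closure P, R.Equiv P x y → x = y) :
    ∃ r, R.IsRetraction P r := by
  choose r hr hE using hP
  refine ⟨r, ?_, hr, hE⟩
  have hPc : IsClosed P := isClosed_of_closure_subset fun x hx => by
    rw [hcl x hx (r x) (subset_closure (hr x)) (hE x)]
    exact hr x
  let G : Set (K × K) := {z | z.2 ∈ P} ∩ ⋂ p ∈ P, {z | z.1 ∈ R.nhd p ↔ z.2 ∈ R.nhd p}
  have hG : IsClosed G := (hPc.preimage continuous_snd).inter <| isClosed_biInter fun p _ =>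
    (isClopen_setOf_mem_nhd_iff continuous_fst continuous_snd p).isClosed
  have hGr : ∀ z, z ∈ G ↔ z.2 = r z.1 := by
    rintro ⟨x, t⟩
    constructor
    · rintro ⟨ht, hxt⟩
      have h : R.Equiv P x t := fun p hp => mem_iInter₂.1 hxt p hp
      exact (h.symm.trans (hE x)).eq ht (hr x)
    · rintro (rfl : t = r x)
      exact ⟨hr x, mem_iInter₂.2 fun p hp => hE x p hp⟩
  refine continuous_iff_isClosed.2 fun C hC => ?_
  convert isClosedMap_fst_of_compactSpace _ (hG.inter (hC.preimage continuous_snd)) using 1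
  ext x
  constructor
  · exact fun hx => ⟨(x, r x), ⟨(hGr _).2 rfl, hx⟩, rfl⟩
  · rintro ⟨⟨x, t⟩, ⟨h, ht⟩, rfl⟩
    obtain rfl : t = r x := (hGr _).1 h
    exact ht

theorem exists_operations [CompactSpace K] [Nonempty K] (R : RankedNhds K) {Y : Type*}
    [TopologicalSpace Y] [CompactSpace Y] {f : K → Y → ℝ} (hK : ∀ y, Continuous fun x => f x y)
    (hY : ∀ x, Continuous (f x)) (hf : Function.Injective f) :
    ∃ φ : Finset K → ℕ → K, ∀ P, IsClosedUnder φ P → ∃ r, R.IsRetraction P r := by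
  choose G hG using R.exists_finset_nhd_cover
  choose Q hQc hQ using exists_countable_approximating f
  choose S hSc hS using fun y => R.exists_countable_equiv_imp_eq (hK y)
  have hΦ : ∀ F, ∃ φ : ℕ → K, (G F : Set K) ∪ ⋃ q ∈ Q F, S q ⊆ range φ := fun F => by
    have hc : ((G F : Set K) ∪ ⋃ q ∈ Q F, S q).Countable :=
      (G F).countable_toSet.union ((hQc F).biUnion fun q _ => hSc q)
    exact Set.countable_iff_exists_subset_range.1 hc
  choose φ hφ using hΦ
  refine ⟨φ, fun P hP => exists_isRetraction (exists_mem_equiv fun F hF x => ?_) ?_⟩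
  · obtain ⟨t, ht, hxt⟩ := hG F x
    obtain ⟨n, rfl⟩ := hφ F (.inl ht)
    exact ⟨_, hP F hF n, hxt⟩
  · intro x hx z hz hxz
    refine hf (funext fun y => ?_)
    refine eq_on_of_separatelyContinuous hK hY (Q := ⋃ F ∈ {F : Finset K | ↑F ⊆ P}, Q F)
      (fun F hF y ε hε => ?_) hx hz (fun q hq => ?_) y
    · obtain ⟨q, hq, h⟩ := hQ F y ε hε
      exact ⟨q, mem_iUnion₂.2 ⟨F, hF, hq⟩, h⟩
    · obtain ⟨F, hF, hqF⟩ := mem_iUnion₂.1 hq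
      refine hS q x z (hxz.mono fun s hs => ?_)
      obtain ⟨n, rfl⟩ := hφ F (.inr (mem_iUnion₂.2 ⟨q, hqF, hs⟩))
      exact hP F hF n

end RankedNhds

namespace RankedNhds

variable {K : Type u} [TopologicalSpace K] {R : RankedNhds K}

theorem finite_setOf_retraction_ne {ι : Type*} [LinearOrder ι] [WellFoundedLT ι]
    {H H' : ι → Set K} {r r' : ι → K → K} (hr : ∀ i, R.IsRetraction (H i) (r i))
    (hr' : ∀ i, R.IsRetraction (H' i) (r' i)) (hH : ∀ i, H' i ⊆ H i)
    (hlt : ∀ i j, i < j → H i ⊆ H' j)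
    (hU : ∀ g : ℕ → ι, StrictMono g → ∃ s, R.IsRetraction (⋃ n, H (g n)) s) (x : K) :
    {i | r i x ≠ r' i x}.Finite := by
  by_contra hinf
  let f := Set.Infinite.natEmbedding _ hinf
  obtain ⟨g, hg | hg⟩ := exists_increasing_or_nonincreasing_subseq (· < ·) fun n => (f n : ι)
  · have hmono : StrictMono fun n => (f (g n) : ι) := fun m n => hg m n
    obtain ⟨s, hs⟩ := hU _ hmono
    obtain ⟨n, hn⟩ := mem_iUnion.1 (hs.mem x)
    have hn' := hlt _ _ (hmono n.lt_succ_self) hn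
    have h1 := (hr' (f (g (n + 1)))).comp hs
      ((hH _).trans (subset_iUnion (fun n => H (f (g n))) (n + 1))) x
    have h2 := (hr (f (g (n + 1)))).comp hs (subset_iUnion (fun n => H (f (g n))) (n + 1)) x
    rw [(hr' _).apply_of_mem hn'] at h1
    rw [(hr _).apply_of_mem (hH _ hn')] at h2
    exact (f (g (n + 1))).2 (h2.symm.trans h1)
  · have hanti : StrictAnti fun n => (f (g n) : ι) := fun m n hmn =>
      (not_lt.1 (hg m n hmn)).lt_of_ne fun h =>
        hmn.ne' (g.injective (f.injective (Subtype.ext h)))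
    exact not_strictAnti_of_wellFoundedLT _ hanti

/-- Strong families on the pieces of a well-ordered filtration of `P` by retracts `H i` combine to a
strong family on `P`, provided every point is moved only finitely often. -/
theorem exists_isStrongFamily_of_filtration {ι : Type*} [LinearOrder ι] [WellFoundedLT ι]
    {P H₀ : Set K} {H H' : ι → Set K} {r₀ : K → K} {r r' : ι → K → K}
    (hr₀ : R.IsRetraction H₀ r₀) (hr : ∀ i, R.IsRetraction (H i) (r i))
    (hr' : ∀ i, R.IsRetraction (H' i) (r' i))
    (hH : ∀ i, H' i ⊆ H i) (hmono : Monotone H)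
    (hbot : ∀ i, IsMin i → H' i = H₀) (hlim : ∀ i, ¬ IsMin i → H' i = ⋃ j : Iio i, H j)
    (hP : P ⊆ ⋃ i, H i) (hfin : ∀ x, {i | r i x ≠ r' i x}.Finite)
    (hs₀ : ∃ 𝒱, IsStrongFamily H₀ univ 𝒱) (hs : ∀ i, ∃ 𝒱, IsStrongFamily (H i) univ 𝒱) :
    ∃ 𝒱, IsStrongFamily P univ 𝒱 := by
  obtain ⟨𝒱₀, h𝒱₀⟩ := hs₀
  choose 𝒱 h𝒱 using hs
  let A : ι → Set K → Set K := fun i V => r i ⁻¹' V \ r' i ⁻¹' V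
  let B : ι → Set K → Set K := fun i V => r' i ⁻¹' V \ r i ⁻¹' V
  refine ⟨(r₀ ⁻¹' ·) '' 𝒱₀ ∪ ⋃ i, (A i '' 𝒱 i ∪ B i '' 𝒱 i), ?_, ?_, ?_⟩
  · rintro W (⟨V, hV, rfl⟩ | hW)
    · exact (h𝒱₀.isClopen V hV).preimage hr₀.continuous
    · obtain ⟨i, ⟨V, hV, rfl⟩ | ⟨V, hV, rfl⟩⟩ := mem_iUnion.1 hW
      · exact (((h𝒱 i).isClopen V hV).preimage (hr i).continuous).diff
          (((h𝒱 i).isClopen V hV).preimage (hr' i).continuous)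
      · exact (((h𝒱 i).isClopen V hV).preimage (hr' i).continuous).diff
          (((h𝒱 i).isClopen V hV).preimage (hr i).continuous)
  · intro x _
    refine (((h𝒱₀.finite _ (hr₀.mem x)).image (r₀ ⁻¹' ·)).union <| (hfin x).biUnion fun i _ =>
      (((h𝒱 i).finite _ ((hr i).mem x)).image (A i)).union
        (((h𝒱 i).finite _ (hH i ((hr' i).mem x))).image (B i))).subset ?_
    rintro W ⟨⟨V, hV, rfl⟩ | hW, hx⟩
    · exact .inl ⟨V, ⟨hV, hx⟩, rfl⟩
    · obtain ⟨i, ⟨V, hV, rfl⟩ | ⟨V, hV, rfl⟩⟩ := mem_iUnion.1 hW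
      · refine .inr (mem_iUnion₂.2 ⟨i, fun h => hx.2 ?_, .inl ⟨V, ⟨hV, hx.1⟩, rfl⟩⟩)
        exact (congrArg (· ∈ V) h).mp hx.1
      · refine .inr (mem_iUnion₂.2 ⟨i, fun h => hx.2 ?_, .inr ⟨V, ⟨hV, hx.1⟩, rfl⟩⟩)
        exact (congrArg (· ∈ V) h).mpr hx.1
  · intro x hx y hy hxy
    have h₀ : r₀ x = r₀ y :=
      h𝒱₀.separates _ ⟨mem_univ _, hr₀.mem x⟩ _ ⟨mem_univ _, hr₀.mem y⟩ fun V hV =>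
        hxy _ (.inl ⟨V, hV, rfl⟩)
    have key : ∀ i, r i x = r i y := by
      intro i
      induction i using WellFoundedLT.induction with
      | ind i ih =>
        have hi : r' i x = r' i y := by
          by_cases hmin : IsMin i
          · have e : ∀ z, r' i z = r₀ z := fun z =>
              (hr' i).eq ((hbot i hmin).ge (hr₀.mem z)) ((hbot i hmin).symm ▸ hr₀.equiv z)
            rw [e, e, h₀]
          · have hx' := (hr' i).mem x
            have hy' := (hr' i).mem y
            rw [hlim i hmin] at hx' hy'
            obtain ⟨j, hj⟩ := mem_iUnion.1 hx'
            obtain ⟨k, hk⟩ := mem_iUnion.1 hy'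
            have hm : max j.1 k.1 < i := max_lt j.2 k.2
            have hsub : H (max j.1 k.1) ⊆ H' i := by
              rw [hlim i hmin]
              exact subset_iUnion (fun j : Iio i => H j) ⟨_, hm⟩
            have h1 := (hr (max j.1 k.1)).comp (hr' i) hsub x
            have h2 := (hr (max j.1 k.1)).comp (hr' i) hsub y
            rw [(hr _).apply_of_mem (hmono (le_max_left _ _) hj)] at h1
            rw [(hr _).apply_of_mem (hmono (le_max_right _ _) hk)] at h2
            rw [h1, h2, ih _ hm]
        refine (h𝒱 i).separates _ ⟨mem_univ _, (hr i).mem x⟩ _ ⟨mem_univ _, (hr i).mem y⟩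
          fun V hV => ?_
        have hA := hxy (A i V) (.inr (mem_iUnion.2 ⟨i, .inl ⟨V, hV, rfl⟩⟩))
        have hB := hxy (B i V) (.inr (mem_iUnion.2 ⟨i, .inr ⟨V, hV, rfl⟩⟩))
        simp only [A, B, mem_sdiff, mem_preimage, hi] at hA hB
        tauto
    obtain ⟨i, hi⟩ := mem_iUnion.1 (hP hx.2)
    obtain ⟨j, hj⟩ := mem_iUnion.1 (hP hy.2)
    have := key (max i j)
    rwa [(hr _).apply_of_mem (hmono (le_max_left _ _) hi),
      (hr _).apply_of_mem (hmono (le_max_right _ _) hj)] at this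

theorem exists_isStrongFamily {φ : Finset K → ℕ → K}
    (hφ : ∀ P, IsClosedUnder φ P → ∃ r, R.IsRetraction P r) (P : Set K) :
    ∃ 𝒱, IsStrongFamily P univ 𝒱 := by
  induction hκ : #P using WellFoundedLT.induction generalizing P with
  | ind κ ih =>
    rcases le_or_gt κ ℵ₀ with hle | hgt
    · exact R.exists_isStrongFamily_of_countable (Cardinal.le_aleph0_iff_set_countable.1 (hκ ▸ hle))
    obtain ⟨e⟩ : Nonempty (κ.ord.ToType ≃ P) := Cardinal.eq.1 (by simp [hκ])
    let a : κ.ord.ToType → K := fun i => e i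
    have hcard : ∀ S, #(a '' S) < κ → ∃ 𝒱, IsStrongFamily (closedHull φ (a '' S)) univ 𝒱 :=
      fun S hS => ih _ (mk_closedHull_le.trans_lt (max_lt hgt hS)) _ rfl
    have hmono : Monotone fun i => closedHull φ (a '' Iic i) := fun i j hij =>
      closedHull_mono (image_mono (Iic_subset_Iic.2 hij))
    have hdir : ∀ S : Set κ.ord.ToType,
        Directed (· ⊆ ·) fun i : S => closedHull φ (a '' Iic i.1) := fun S =>
      (hmono.comp (Subtype.mono_coe (· ∈ S))).directed_le
    have hret : ∀ S, ∃ r, R.IsRetraction (closedHull φ (a '' S)) r := fun S =>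
      hφ _ isClosedUnder_closedHull
    choose r hr using hret
    refine exists_isStrongFamily_of_filtration (P := P) (hr ∅) (fun i => hr (Iic i))
      (fun i => hr (Iio i)) (fun i => closedHull_mono (image_mono Iio_subset_Iic_self)) hmono
      (fun i hi => by rw [hi.Iio_eq]) (fun i hi => ?_) (fun x hx => ?_) ?_
      (hcard ∅ (by simpa using Cardinal.aleph0_pos.trans hgt)) (fun i => hcard _ ?_)
    · obtain ⟨j, hj⟩ := not_isMin_iff.1 hi
      have : Nonempty (Iio i) := ⟨⟨j, hj⟩⟩
      refine (closedHull_subset (IsClosedUnder.iUnion_of_directed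
        (fun _ => isClosedUnder_closedHull) (hdir _)) ?_).antisymm (iUnion_subset fun j =>
          closedHull_mono (image_mono (Iic_subset_Iio.2 j.2)))
      rintro _ ⟨j, hj, rfl⟩
      exact mem_iUnion.2 ⟨⟨j, hj⟩, subset_closedHull ⟨j, self_mem_Iic, rfl⟩⟩
    · exact mem_iUnion.2 ⟨e.symm ⟨x, hx⟩, subset_closedHull ⟨_, self_mem_Iic, by simp [a]⟩⟩
    · refine finite_setOf_retraction_ne (fun i => hr (Iic i)) (fun i => hr (Iio i))
        (fun i => closedHull_mono (image_mono Iio_subset_Iic_self))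
        (fun i j hij => closedHull_mono (image_mono (Iic_subset_Iio.2 hij))) fun g hg => hφ _ ?_
      exact IsClosedUnder.iUnion_of_directed (fun _ => isClosedUnder_closedHull)
        (hmono.comp hg.monotone).directed_le
    · refine Cardinal.mk_image_le.trans_lt ?_
      simpa using Cardinal.mk_Iic_lt i (by simp) (by simpa using hgt.le)

end RankedNhds

/-- Point-finite families of clopen sets separating the points of a compact space embed it into a
Cantor cube. -/
theorem IsStrongFamily.isEmbedding {X : Type*} [TopologicalSpace X] [CompactSpace X]
    {𝒱 : Set (Set X)} (h : IsStrongFamily univ univ 𝒱) :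
    IsEmbedding fun (x : X) (V : 𝒱) => V.1.boolIndicator x := by
  refine (Continuous.isClosedEmbedding (continuous_pi fun V => ?_) fun x y hxy => ?_).isEmbedding
  · exact (continuous_boolIndicator_iff_isClopen _).2 (h.isClopen V V.2)
  · refine h.separates x (by simp) y (by simp) fun V hV => ?_
    rw [mem_iff_boolIndicator, mem_iff_boolIndicator, show V.boolIndicator x = V.boolIndicator y from
      congrFun hxy ⟨V, hV⟩]

theorem discreteTopology_setOf_ncard_eq {X Γ : Type*} [TopologicalSpace X] {e : X → Γ → Bool}
    (he : Continuous e) (hinj : Function.Injective e)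
    (hfin : ∀ x, {γ | e x γ = true}.Finite) (n : ℕ) :
    DiscreteTopology {x | {γ | e x γ = true}.ncard = n} := by
  refine discreteTopology_subtype_iff'.2 fun x hx => ?_
  refine ⟨⋂ γ ∈ {γ | e x γ = true}, {z | e z γ = true}, ?_, ?_⟩
  · exact (hfin x).isOpen_biInter fun γ _ =>
      (isOpen_discrete {true}).preimage ((continuous_apply γ).comp he)
  · refine Subset.antisymm ?_ ?_
    · rintro z ⟨hz, hzn⟩
      have hsub : {γ | e x γ = true} ⊆ {γ | e z γ = true} := fun γ hγ => mem_iInter₂.1 hz γ hγ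
      have heq := Set.eq_of_subset_of_ncard_le hsub (hzn.trans hx.symm).le (hfin z)
      exact hinj (funext fun γ => Bool.eq_iff_iff.2 (Set.ext_iff.1 heq.symm γ))
    · rintro _ rfl
      exact ⟨mem_iInter₂.2 fun γ hγ => hγ, hx⟩

/-- Every scattered Eberlein compact space is σ-discrete; more precisely, a scattered
Eberlein compact space `K` embeds into `{0,1}^Γ` for some `Γ` in such a way that every
point of `K` has finite support, and hence `K` is the countable union of the discrete
subspaces `Xₙ = {x ∈ K : |supp x| = n}`. -/
theorem scattered_eberleinCompact_sigmaDiscrete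
    (K : Type u) [TopologicalSpace K] [CompactSpace K] [T2Space K]
    (hEb : ∃ (Y : Type u) (_ : TopologicalSpace Y), CompactSpace Y ∧ T2Space Y ∧
      ∃ e : K → {g : Y → ℝ // Continuous g}, IsEmbedding e)
    (hsc : IsScattered K) :
    ∃ (Γ : Type u) (e : K → Γ → Bool), IsEmbedding e ∧
      (∀ k : K, {γ : Γ | e k γ = true}.Finite) ∧
      (⋃ n : ℕ, {k : K | {γ : Γ | e k γ = true}.ncard = n}) = Set.univ ∧
      ∀ n : ℕ, DiscreteTopology {k : K | {γ : Γ | e k γ = true}.ncard = n} := by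
  obtain ⟨R⟩ := hsc.nonempty_rankedNhds
  obtain ⟨𝒱, h𝒱⟩ : ∃ 𝒱, IsStrongFamily (univ : Set K) univ 𝒱 := by
    rcases isEmpty_or_nonempty K with hK | hK
    · exact R.exists_isStrongFamily_of_countable (to_countable _)
    obtain ⟨Y, _, _, _, f, hf⟩ := hEb
    obtain ⟨φ, hφ⟩ := R.exists_operations (f := fun k y => (f k).1 y)
      (fun y => (continuous_apply y).comp (continuous_subtype_val.comp hf.continuous))
      (fun k => (f k).2) (Subtype.val_injective.comp hf.injective)
    exact RankedNhds.exists_isStrongFamily hφ univ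
  have hfin : ∀ k : K, {V : 𝒱 | V.1.boolIndicator k = true}.Finite := fun k => by
    simp only [← mem_iff_boolIndicator]
    refine ((h𝒱.finite k (mem_univ k)).preimage Subtype.val_injective.injOn).subset ?_
    exact fun V hV => ⟨V.2, hV⟩
  exact ⟨𝒱, _, h𝒱.isEmbedding, hfin, by ext; simp,
    discreteTopology_setOf_ncard_eq h𝒱.isEmbedding.continuous h𝒱.isEmbedding.injective hfin⟩
end
end

section
/- There exists a T₁ topological space (a topology on the ordinal ω₁·ω₁) that is scattered and hereditarily meta-Lindelöf but not σ-discrete. -/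
open Set Topology Ordinal Cardinal

noncomputable section
universe u

/-- The points below `y` in the order of `X` whose label under `e` is larger than that of `y`. -/
def invertedBelow {X Y : Type*} [LT X] [LT Y] (e : X → Y) (y : X) : Set X :=
  {x | x < y ∧ e y < e x}

/-- The topology in which a set is open if it contains, along with each of its points `y`,
all but finitely many points of `invertedBelow e y`. -/
@[reducible] def inversionTopology {X Y : Type*} [LT X] [LT Y] (e : X → Y) : TopologicalSpace X where
  IsOpen U := ∀ y ∈ U, (invertedBelow e y \ U).Finite
  isOpen_univ := by simp
  isOpen_inter U V hU hV := by
    intro y hy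
    rw [sdiff_inter]
    exact (hU y hy.1).union (hV y hy.2)
  isOpen_sUnion 𝒰 h := by
    rintro y ⟨U, hU, hy⟩
    exact (h U hU y hy).subset (sdiff_subset_sdiff_right (subset_sUnion_of_mem hU))

section inversionTopology

variable {X Y : Type*} [LinearOrder X] [LinearOrder Y] (e : X → Y)

theorem isOpen_insert_invertedBelow (y : X) :
    IsOpen[inversionTopology e] (insert y (invertedBelow e y)) := by
  rintro z (rfl | hz)
  · simp [sdiff_eq_empty.2 (subset_insert z (invertedBelow e z))]
  · have h : invertedBelow e z ⊆ insert y (invertedBelow e y) := fun w hw =>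
      Or.inr ⟨hw.1.trans hz.1, hz.2.trans hw.2⟩
    simp [sdiff_eq_empty.2 h]

theorem t1Space_inversionTopology : @T1Space X (inversionTopology e) := by
  let _ := inversionTopology e
  refine ⟨fun x => ⟨fun y _ => ?_⟩⟩
  exact (finite_singleton x).subset fun z hz => by simpa using hz.2

theorem isScattered_inversionTopology [WellFoundedLT X] :
    @IsScattered X (inversionTopology e) := by
  let _ := inversionTopology e
  intro S hS
  obtain ⟨y, hy, hmin⟩ := WellFounded.has_min (wellFounded_lt (α := X)) S hS
  refine ⟨y, hy, _, isOpen_insert_invertedBelow e y, ?_⟩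
  ext z
  constructor
  · rintro ⟨rfl | hz, hzS⟩
    · rfl
    · exact (hmin z hzS hz.1).elim
  · rintro rfl
    exact ⟨Or.inl rfl, hy⟩

theorem hereditarilyMetaLindelof_inversionTopology (he : ∀ x, {y | e y ≤ e x}.Countable) :
    @HereditarilyMetaLindelof X (inversionTopology e) := by
  let _ := inversionTopology e
  intro S 𝒰 hopen hcover
  have hmem : ∀ x : S, ∃ U ∈ 𝒰, x ∈ U := fun x => by
    rw [← mem_sUnion, hcover]
    trivial
  choose U hU hxU using hmem
  let V : S → Set S := fun x => U x ∩ Subtype.val ⁻¹' insert x.1 (invertedBelow e x.1)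
  refine ⟨range V, ?_, ?_, ?_, fun z => ?_⟩
  · rintro _ ⟨x, rfl⟩
    exact (hopen _ (hU x)).inter
      ((isOpen_insert_invertedBelow e x.1).preimage continuous_subtype_val)
  · exact eq_univ_of_forall fun x => ⟨V x, mem_range_self x, hxU x, Or.inl rfl⟩
  · rintro _ ⟨x, rfl⟩
    exact ⟨U x, hU x, inter_subset_left⟩
  · have hc : {x : S | e x.1 ≤ e z.1}.Countable :=
      (he z.1).preimage Subtype.val_injective
    refine (hc.image V).mono ?_
    rintro _ ⟨⟨x, rfl⟩, hz⟩
    refine ⟨x, ?_, rfl⟩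
    rcases hz.2 with h | h
    · exact (congrArg e h).ge
    · exact h.2.le

theorem finite_invertedBelow_inter_of_discreteTopology {D : Set X}
    (hD : @DiscreteTopology D (@instTopologicalSpaceSubtype X (· ∈ D) (inversionTopology e)))
    {y : X} (hy : y ∈ D) : (invertedBelow e y ∩ D).Finite := by
  let _ := inversionTopology e
  obtain ⟨U, hU, hUD⟩ := isOpen_induced_iff.1 (isOpen_discrete ({⟨y, hy⟩} : Set D))
  have hmem : ∀ z (hz : z ∈ D), z ∈ U ↔ z = y := fun z hz => by
    simpa using Set.ext_iff.1 hUD ⟨z, hz⟩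
  refine (hU y ((hmem y hy).2 rfl)).subset ?_
  rintro z ⟨hz, hzD⟩
  exact ⟨hz, fun hzU => hz.1.ne ((hmem z hzD).1 hzU)⟩

/-- If `X` contains an uncountable family of uncountable sets, any two of which are comparable
in the order of `X`, then it is not σ-discrete in the inversion topology. -/
theorem not_isSigmaDiscrete_inversionTopology (he : ∀ x, {y | e y ≤ e x}.Countable)
    {ι : Type*} [LinearOrder ι] [Uncountable ι] (L : ι → Set X) (hL : ∀ i, ¬ (L i).Countable)
    (hlt : ∀ i j, i < j → ∀ x ∈ L i, ∀ y ∈ L j, x < y) :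
    ¬ @IsSigmaDiscrete X (inversionTopology e) := by
  let _ := inversionTopology e
  rintro ⟨D, hD, hdisc⟩
  have hex : ∀ i, ∃ n, ¬ (L i ∩ D n).Countable := by
    intro i
    by_contra! h
    apply hL i
    rw [← inter_univ (L i), ← hD, inter_iUnion]
    exact countable_iUnion h
  choose n hn using hex
  have hpair : ∃ i j, i < j ∧ n i = n j := by
    by_contra! h
    have hinj : Function.Injective n := fun i j hij => by
      rcases lt_trichotomy i j with hlt | heq | hgt
      · exact (h i j hlt hij).elim
      · exact heq
      · exact (h j i hgt hij.symm).elim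
    exact not_countable hinj.countable
  obtain ⟨i, j, hij, hnij⟩ := hpair
  obtain ⟨y, hyL, hyD⟩ : (L j ∩ D (n j)).Nonempty := by
    by_contra h
    exact hn j (by simp [not_nonempty_iff_eq_empty.1 h])
  have hfin := finite_invertedBelow_inter_of_discreteTopology e (hdisc (n j)) hyD
  apply hn i
  refine (hfin.countable.union (he y)).mono ?_
  rintro x ⟨hxL, hxD⟩
  rcases lt_or_ge (e y) (e x) with h | h
  · exact Or.inl ⟨⟨hlt i j hij x hxL y hyL, h⟩, hnij ▸ hxD⟩
  · exact Or.inr h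

end inversionTopology

theorem uncountable_Iio_omega_one : Uncountable (Iio (ω₁ : Ordinal.{u})) := by
  rw [← Cardinal.aleph0_lt_mk_iff, Cardinal.mk_Iio_ordinal]
  simp

theorem countable_Iic_of_lt_omega_one (a : Iio (ω₁ : Ordinal.{u})) : (Iic a).Countable := by
  have h : (Iio (Order.succ a.1)).Countable := by
    rw [← Cardinal.le_aleph0_iff_set_countable, Cardinal.mk_Iio_ordinal, Cardinal.lift_le_aleph0,
      ← Order.lt_succ_iff, succ_aleph0, ← lt_ord, ord_aleph]
    exact (isSuccLimit_omega 1).succ_lt a.2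
  exact (h.preimage (Subtype.val_injective (p := (· ∈ Iio (ω₁ : Ordinal.{u}))))).mono
    fun b hb => Order.lt_succ_of_le (show b.1 ≤ a.1 from hb)

theorem nonempty_embedding_Iio_omega_one :
    Nonempty ({o : Ordinal.{u} // o < ω₁ * ω₁} ↪ Iio (ω₁ : Ordinal.{u})) := by
  rw [← Cardinal.le_def]
  change #(Iio (ω₁ * ω₁ : Ordinal.{u})) ≤ _
  simp [Cardinal.mk_Iio_ordinal]

/-- There is a topology on the ordinal `ω₁ · ω₁` which is `T₁`, scattered and
hereditarily meta-Lindelöf, but not σ-discrete. -/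
theorem exists_T1_scattered_heredMetaLindelof_not_sigmaDiscrete :
    ∃ t : TopologicalSpace {o : Ordinal // o < ω₁ * ω₁},
      @T1Space _ t ∧ @IsScattered _ t ∧ @HereditarilyMetaLindelof _ t ∧
        ¬ @IsSigmaDiscrete _ t := by
  obtain ⟨e⟩ := nonempty_embedding_Iio_omega_one
  have he : ∀ x, {y | e y ≤ e x}.Countable := fun x =>
    (countable_Iic_of_lt_omega_one (e x)).preimage e.injective
  have := uncountable_Iio_omega_one
  refine ⟨inversionTopology e, t1Space_inversionTopology e, isScattered_inversionTopology e,
    hereditarilyMetaLindelof_inversionTopology e he, ?_⟩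
  have hblock : ∀ a b : Ordinal, a < ω₁ → b < ω₁ → ω₁ * a + b < ω₁ * Order.succ a := by
    intro a b _ hb
    rw [mul_succ]
    exact add_lt_add_right hb _
  have hle : ∀ a c : Ordinal, a < c → ω₁ * Order.succ a ≤ ω₁ * c := fun a c h =>
    mul_le_mul_right (Order.succ_le_of_lt h) _
  let f : Iio ω₁ → Iio ω₁ → {o : Ordinal // o < ω₁ * ω₁} := fun a b =>
    ⟨ω₁ * a.1 + b.1, (hblock a.1 b.1 a.2 b.2).trans_le (hle a.1 ω₁ a.2)⟩
  refine not_isSigmaDiscrete_inversionTopology e he (fun a => range (f a)) (fun a hc => ?_) ?_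
  · have hinj : Function.Injective (f a) := fun b c h =>
      Subtype.ext (add_left_cancel (congrArg Subtype.val h))
    have := hc.to_subtype
    exact not_countable (α := Iio ω₁) (hinj.codRestrict mem_range_self).countable
  · rintro a c hac _ ⟨b, rfl⟩ _ ⟨d, rfl⟩
    exact ((hblock a.1 b.1 a.2 b.2).trans_le (hle a.1 c.1 hac)).trans_le
      (le_self_add)
end
end
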